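/- arXiv:2005.09514 — 3 statements merged into one kernel-verified Lean document; each statement's English description precedes it below -/
import Mathlib

section
/- Let n ≥ 2, s > 0, m > s be an integer, a = (a_1,…,a_n) ∈ ℝ^n with a_i > 0, and let ℓ ∈ ℕ be such that s − ℓ > −1. Then (L_{m,s} u_{s−ℓ})(x) = 0 for every x ∈ E_a; i.e., the functions u_{s−ℓ}(x) = (1−|x|_a²)_+^{s−ℓ} are pointwise s-harmonic in the ellipsoid E_a. -/
open MeasureTheory Finset Filter
open scoped BigOperators NNReal ENNReal FourierTransform

noncomputable section

/-- Finite difference of order `2m`: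
`δ_m u(x,y) = ∑_{k=-m}^m (-1)^k binom(2m, m-k) u(x + k y)`. -/
def finDiff (n m : ℕ) (u : EuclideanSpace ℝ (Fin n) → ℝ) (x y : EuclideanSpace ℝ (Fin n)) : ℝ :=
  ∑ k ∈ Finset.Icc (-(m : ℤ)) (m : ℤ),
    (-1 : ℝ) ^ k * (Nat.choose (2 * m) ((m : ℤ) - k).toNat : ℝ) * u (x + (k : ℝ) • y)

open Classical in
/-- The normalizing constant `c_{n,m,s}`. -/
def cnms (n m : ℕ) (s : ℝ) : ℝ :=
  if ∃ j : ℕ, s = (j : ℝ) then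
    (4 : ℝ) ^ s * Real.Gamma ((n : ℝ) / 2 + s) * Real.Gamma (s + 1) /
        (2 * Real.pi ^ ((n : ℝ) / 2)) *
      (∑ k ∈ Finset.Icc 2 m, (-1 : ℝ) ^ (k + 1 + ⌊s⌋₊) * (Nat.choose (2 * m) (m - k) : ℝ) *
          (k : ℝ) ^ (2 * s) * Real.log (k : ℝ))⁻¹
  else
    (4 : ℝ) ^ s * Real.Gamma ((n : ℝ) / 2 + s) /
        (Real.pi ^ ((n : ℝ) / 2) * Real.Gamma (-s)) *
      (∑ k ∈ Finset.Icc 1 m, (-1 : ℝ) ^ k * (Nat.choose (2 * m) (m - k) : ℝ) *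
          (k : ℝ) ^ (2 * s))⁻¹

/-- Pointwise hypersingular-integral realization `L_{m,s}` of the fractional
Laplacian `(-Δ)^s`. -/
def Lms (n m : ℕ) (s : ℝ) (u : EuclideanSpace ℝ (Fin n) → ℝ)
    (x : EuclideanSpace ℝ (Fin n)) : ℝ :=
  cnms n m s / 2 * ∫ y : EuclideanSpace ℝ (Fin n), finDiff n m u x y / ‖y‖ ^ ((n : ℝ) + 2 * s)

/-- `|x|_a² = ∑ aᵢ xᵢ²`. -/
def qa (n : ℕ) (a : Fin n → ℝ) (x : EuclideanSpace ℝ (Fin n)) : ℝ := ∑ i, a i * x i ^ 2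

/-- The open ellipsoid `E_a`. -/
def Ea (n : ℕ) (a : Fin n → ℝ) : Set (EuclideanSpace ℝ (Fin n)) := {x | qa n a x < 1}

/-- `u_β(x) = (1 - |x|_a²)₊^β`. -/
def uPow (n : ℕ) (a : Fin n → ℝ) (β : ℝ) (x : EuclideanSpace ℝ (Fin n)) : ℝ :=
  max 0 (1 - qa n a x) ^ β

/-- `⟨x, θ⟩_a = ∑ aᵢ xᵢ θᵢ`. -/
def aInner (n : ℕ) (a : Fin n → ℝ) (x θ : EuclideanSpace ℝ (Fin n)) : ℝ :=
  ∑ i, a i * x i * θ i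

/-- `Aθ` for `A = diag a`. -/
def Avec (n : ℕ) (a : Fin n → ℝ) (θ : EuclideanSpace ℝ (Fin n)) : EuclideanSpace ℝ (Fin n) :=
  (WithLp.equiv 2 (Fin n → ℝ)).symm fun i => a i * θ i

/-- `∫_{∂E_a} f dμ`, where `μ(dθ) = dθ / (|θ|^{n+2s} |Aθ|)` and `dθ` is the
`(n-1)`-dimensional Hausdorff (surface) measure on `∂E_a`. -/
def surfInt (n : ℕ) (s : ℝ) (a : Fin n → ℝ) (f : EuclideanSpace ℝ (Fin n) → ℝ) : ℝ :=
  ∫ θ in {θ : EuclideanSpace ℝ (Fin n) | qa n a θ = 1},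
    f θ / (‖θ‖ ^ ((n : ℝ) + 2 * s) * ‖Avec n a θ‖) ∂(μH[(n : ℝ) - 1])

/-- `k_{n,s} = 2^{2s-1} Γ(n/2+s) / π^{n/2}`. -/
def kns (n : ℕ) (s : ℝ) : ℝ :=
  (2 : ℝ) ^ (2 * s - 1) * Real.Gamma ((n : ℝ) / 2 + s) / Real.pi ^ ((n : ℝ) / 2)

/-- `J₀ = ∫_{∂E_a} μ(dθ)`. -/
def J0fun (n : ℕ) (s : ℝ) (a : Fin n → ℝ) : ℝ := surfInt n s a fun _ => 1

/-- `J_i^{(k)} = a_k^i ∫_{∂E_a} θ_k^{2i} μ(dθ)`. -/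
def Jik (n : ℕ) (s : ℝ) (a : Fin n → ℝ) (i : ℕ) (k : Fin n) : ℝ :=
  a k ^ i * surfInt n s a fun θ => θ k ^ (2 * i)

/-- Gauss hypergeometric function `₂F₁(α, β; γ; z)`. -/
def hyp2F1 (α β γ z : ℝ) : ℝ :=
  ∑' k : ℕ, (ascPochhammer ℝ k).eval α * (ascPochhammer ℝ k).eval β /
      ((ascPochhammer ℝ k).eval γ * (Nat.factorial k : ℝ)) * z ^ k

/-- The weight vector `(1, …, 1, a)`. -/
def avec (n : ℕ) (a : ℝ) : Fin n → ℝ := fun i => if (i : ℕ) = n - 1 then a else 1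

/-- Beta function `B(x,y) = Γ(x)Γ(y)/Γ(x+y)`. -/
def realBeta (x y : ℝ) : ℝ := Real.Gamma x * Real.Gamma y / Real.Gamma (x + y)

/-- Surface measure `ω_d = 2 π^{(d+1)/2} / Γ((d+1)/2)` of the unit `d`-sphere. -/
def sphVol (d : ℝ) : ℝ := 2 * Real.pi ^ ((d + 1) / 2) / Real.Gamma ((d + 1) / 2)

/-- Point inversion `σ(x) = c (x+ν)/|x+ν|² - ν`. -/
def ptInv (n : ℕ) (c : ℝ) (ν x : EuclideanSpace ℝ (Fin n)) : EuclideanSpace ℝ (Fin n) :=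
  (c / ‖x + ν‖ ^ 2) • (x + ν) - ν

/-- `Ω(a,c,ν) = σ(E_a)` (the set of `x ≠ -ν` with `σ(x) ∈ E_a`). -/
def Omg (n : ℕ) (c : ℝ) (ν : EuclideanSpace ℝ (Fin n)) (a : Fin n → ℝ) :
    Set (EuclideanSpace ℝ (Fin n)) :=
  {x | x ≠ -ν ∧ qa n a (ptInv n c ν x) < 1}

open Classical in
/-- The transformed torsion function `w_s(x) = |x+ν|^{2s-n} u_s(σ(x))`, extended by `0` at `-ν`. -/
def ws (n : ℕ) (s c : ℝ) (ν : EuclideanSpace ℝ (Fin n)) (a : Fin n → ℝ)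
    (x : EuclideanSpace ℝ (Fin n)) : ℝ :=
  if x = -ν then 0 else ‖x + ν‖ ^ (2 * s - (n : ℝ)) * uPow n a s (ptInv n c ν x)

/-- `(Ax)·y` for a general matrix `A`. -/
def qA (n : ℕ) (A : Matrix (Fin n) (Fin n) ℝ) (x y : EuclideanSpace ℝ (Fin n)) : ℝ :=
  ∑ i, ∑ j, A i j * x j * y i

/-- The weight of `u (x + k y)` in the finite difference of order `2m`. -/
def fdCoeff (m : ℕ) (k : ℤ) : ℝ := (-1) ^ k * (Nat.choose (2 * m) ((m : ℤ) - k).toNat : ℝ)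

lemma fdCoeff_neg {m : ℕ} {k : ℤ} (hk : k ∈ Finset.Icc (-(m : ℤ)) m) :
    fdCoeff m (-k) = fdCoeff m k := by
  rw [Finset.mem_Icc] at hk
  unfold fdCoeff
  rw [zpow_neg, ← inv_zpow, inv_neg, inv_one, ← Nat.choose_symm (by omega)]
  congr 3
  omega

lemma sum_Icc_neg_comp (m : ℕ) (f : ℤ → ℝ) :
    ∑ k ∈ Finset.Icc (-(m : ℤ)) m, f (-k) = ∑ k ∈ Finset.Icc (-(m : ℤ)) m, f k :=
  Finset.sum_nbij' (fun k => -k) (fun k => -k)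
    (fun k hk => by simp only [Finset.mem_Icc] at hk ⊢; omega)
    (fun k hk => by simp only [Finset.mem_Icc] at hk ⊢; omega)
    (fun k _ => neg_neg k) (fun k _ => neg_neg k) (fun k _ => rfl)

lemma sum_fdCoeff_mul_pow {m i : ℕ} (hi : i < 2 * m) :
    ∑ k ∈ Finset.Icc (-(m : ℤ)) m, fdCoeff m k * (k : ℝ) ^ i = 0 := by
  have h := congrFun (fwdDiff_iter_pow_eq_zero_of_lt (R := ℝ) hi) (-(m : ℝ))
  rw [fwdDiff_iter_eq_sum_shift] at h
  have hm : (-1 : ℝ) ^ m * (-1) ^ m = 1 := by rw [← mul_pow]; norm_num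
  rw [← mul_zero ((-1 : ℝ) ^ m), ← Pi.zero_apply (M := fun _ : ℝ => ℝ) (-(m : ℝ)), ← h,
    Finset.mul_sum]
  refine Finset.sum_nbij' (fun k => (k + m).toNat) (fun j => (j : ℤ) - m) ?_ ?_ ?_ ?_ ?_
  · intro k hk; simp only [Finset.mem_Icc, Finset.mem_range] at hk ⊢; omega
  · intro k hk; simp only [Finset.mem_Icc, Finset.mem_range] at hk ⊢; omega
  · intro k hk; simp only [Finset.mem_Icc] at hk; omega
  · intro k hk; simp only [Finset.mem_range] at hk; omega
  · intro k hk
    rw [Finset.mem_Icc] at hk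
    obtain ⟨j, rfl⟩ : ∃ j : ℕ, k = (j : ℤ) - m := ⟨(k + m).toNat, by omega⟩
    have hj : j ≤ 2 * m := by omega
    have h1 : ((m : ℤ) - ((j : ℤ) - m)).toNat = 2 * m - j := by omega
    have h2 : ((j : ℤ) - m + m).toNat = j := by omega
    have h3 : (-1 : ℝ) ^ ((j : ℤ) - m) = (-1) ^ m * (-1) ^ (2 * m - j) := by
      have h4 : (j : ℤ) - m = ((m + (2 * m - j) : ℕ) : ℤ) + 2 * ((j : ℤ) - 2 * m) := by
        push_cast [hj]; ring
      rw [← pow_add, h4, zpow_add₀ (by norm_num), zpow_mul, zpow_natCast]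
      norm_num
    unfold fdCoeff
    rw [h1, h2, Nat.choose_symm hj, h3, zsmul_eq_mul, nsmul_eq_mul]
    push_cast
    ring

open Asymptotics in
/-- Centred differences of order `2m` annihilate the Taylor polynomial of degree `< 2m`. -/
lemma sum_fdCoeff_isBigO {E : Type*} [NormedAddCommGroup E] [NormedSpace ℝ E] (m : ℕ)
    {ψ : E → ℝ} (hψ : AnalyticAt ℝ ψ 0) :
    (fun w : E => ∑ k ∈ Finset.Icc (-(m : ℤ)) m, fdCoeff m k * ψ ((k : ℝ) • w))
      =O[nhds 0] fun w => ‖w‖ ^ (2 * m) := by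
  obtain ⟨p, hp⟩ := hψ
  have h0 : ∀ w : E, ∑ k ∈ Finset.Icc (-(m : ℤ)) m,
      fdCoeff m k * p.partialSum (2 * m) ((k : ℝ) • w) = 0 := by
    intro w
    simp only [FormalMultilinearSeries.partialSum, Finset.mul_sum]
    rw [Finset.sum_comm]
    refine Finset.sum_eq_zero fun i hi => ?_
    have : ∀ k : ℤ, (p i fun _ => (k : ℝ) • w) = (k : ℝ) ^ i * p i fun _ => w := by
      intro k
      simpa using (p i).map_smul_univ (fun _ => (k : ℝ)) (fun _ => w)
    simp only [this, ← mul_assoc]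
    rw [← Finset.sum_mul, sum_fdCoeff_mul_pow (Finset.mem_range.1 hi), zero_mul]
  have key : ∀ k : ℤ, (fun w : E => fdCoeff m k *
      (ψ ((k : ℝ) • w) - p.partialSum (2 * m) ((k : ℝ) • w)))
      =O[nhds 0] fun w => ‖w‖ ^ (2 * m) := by
    intro k
    refine IsBigO.const_mul_left ?_ _
    have ht : Tendsto (fun w : E => (k : ℝ) • w) (nhds 0) (nhds 0) := by
      simpa using (continuous_const_smul (k : ℝ)).tendsto (0 : E)
    have h := (hp.isBigO_sub_partialSum_pow (2 * m)).comp_tendsto ht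
    simp only [Function.comp_def, zero_add] at h
    refine h.trans ?_
    simp only [norm_smul, mul_pow]
    exact IsBigO.const_mul_left (isBigO_refl _ _) _
  refine (IsBigO.sum (s := Finset.Icc (-(m : ℤ)) m) fun k _ => key k).congr_left fun w => ?_
  simp only [Finset.sum_apply, mul_sub, Finset.sum_sub_distrib, h0, sub_zero]

lemma sum_fdCoeff_integral_isBigO (m : ℕ) {Ψ : ℝ × ℝ → ℝ} (hΨ : AnalyticAt ℝ Ψ 0) :
    (fun ε : ℝ => ∑ k ∈ Finset.Icc (-(m : ℤ)) m,
        fdCoeff m k * ∫ σ in (0 : ℝ)..1, Ψ (k * ε, σ * (k * ε)))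
      =O[nhds 0] fun ε => ε ^ (2 * m) := by
  obtain ⟨K, hK⟩ := (sum_fdCoeff_isBigO m hΨ).bound
  obtain ⟨r, hr, hr'⟩ := Metric.eventually_nhds_iff.1 hK
  obtain ⟨r₂, hr₂, hr₂'⟩ := Metric.eventually_nhds_iff.1 hΨ.eventually_analyticAt
  have hnorm : ∀ ε σ : ℝ, σ ∈ Set.Icc (0 : ℝ) 1 → ‖((ε, σ * ε) : ℝ × ℝ)‖ = |ε| := by
    intro ε σ hσ
    rw [Prod.norm_def, Real.norm_eq_abs, Real.norm_eq_abs, abs_mul, abs_of_nonneg hσ.1]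
    exact max_eq_left (mul_le_of_le_one_left (abs_nonneg _) hσ.2)
  have hr₃ : 0 < r₂ / (m + 1) := by positivity
  refine Asymptotics.IsBigO.of_bound K ?_
  filter_upwards [Metric.ball_mem_nhds (0 : ℝ) (lt_min hr hr₃)] with ε hε
  rw [Metric.mem_ball, dist_zero_right, Real.norm_eq_abs, lt_min_iff, lt_div_iff₀ (by positivity)]
    at hε
  have hint : ∀ k ∈ Finset.Icc (-(m : ℤ)) m,
      IntervalIntegrable (fun σ : ℝ => fdCoeff m k * Ψ (k * ε, σ * (k * ε))) volume 0 1 := by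
    intro k hk
    refine (ContinuousOn.intervalIntegrable_of_Icc zero_le_one fun σ hσ => ?_).const_mul _
    have hk' : |(k : ℝ)| ≤ m + 1 := by
      rw [Finset.mem_Icc] at hk
      have h1 : (-(m : ℝ)) ≤ k := by exact_mod_cast hk.1
      have h2 : (k : ℝ) ≤ m := by exact_mod_cast hk.2
      rw [abs_le]; constructor <;> linarith
    have hc : ContinuousAt Ψ (k * ε, σ * (k * ε)) := by
      refine (hr₂' ?_).continuousAt
      rw [dist_zero_right, hnorm _ _ hσ, abs_mul]
      nlinarith [mul_le_mul_of_nonneg_right hk' (abs_nonneg ε)]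
    exact (ContinuousAt.comp (f := fun σ : ℝ => ((k * ε, σ * (k * ε)) : ℝ × ℝ)) hc
      (by fun_prop)).continuousWithinAt
  simp_rw [← intervalIntegral.integral_const_mul]
  rw [← intervalIntegral.integral_finsetSum hint]
  refine (intervalIntegral.norm_integral_le_of_norm_le_const (C := K * ‖ε ^ (2 * m)‖)
    fun σ hσ => ?_).trans (by simp)
  rw [Set.uIoc_of_le zero_le_one] at hσ
  have hσ' : σ ∈ Set.Icc (0 : ℝ) 1 := ⟨hσ.1.le, hσ.2⟩
  have h := hr' (y := (ε, σ * ε)) (by rw [dist_zero_right, hnorm _ _ hσ']; exact hε.1)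
  rw [hnorm _ _ hσ'] at h
  simpa [mul_left_comm] using h

lemma fd_integrable_tail {s : ℝ} {h : ℝ → ℝ} (heven : ∀ t, h (-t) = h t) {k : ℤ} (hk : k ≠ 0)
    {ε : ℝ} (hε : 0 < ε)
    (hint : IntegrableOn (fun t => h t * t ^ (-1 - 2 * s)) (Set.Ioi (|(k : ℝ)| * ε))) :
    IntegrableOn (fun t => h (k * t) * t ^ (-1 - 2 * s)) (Set.Ioi ε) ∧
    ∫ t in Set.Ioi ε, h (k * t) * t ^ (-1 - 2 * s) =
      |(k : ℝ)| ^ (2 * s) * ∫ t in Set.Ioi (|(k : ℝ)| * ε), h t * t ^ (-1 - 2 * s) := by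
  have hk0 : 0 < |(k : ℝ)| := abs_pos.2 (Int.cast_ne_zero.2 hk)
  have heq : Set.EqOn (fun t => |(k : ℝ)| ^ (1 + 2 * s) *
      (h (|(k : ℝ)| * t) * (|(k : ℝ)| * t) ^ (-1 - 2 * s)))
      (fun t => h (k * t) * t ^ (-1 - 2 * s)) (Set.Ioi ε) := by
    intro t ht
    have ht0 : 0 < t := hε.trans ht
    have h1 : h (|(k : ℝ)| * t) = h (k * t) := by
      rcases abs_choice (k : ℝ) with h' | h' <;> rw [h']
      rw [neg_mul, heven]
    have h2 : |(k : ℝ)| ^ (1 + 2 * s) * |(k : ℝ)| ^ (-1 - 2 * s) = 1 := by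
      rw [← Real.rpow_add hk0]; ring_nf; simp
    simp only
    rw [h1, Real.mul_rpow hk0.le ht0.le]
    linear_combination (h (k * t) * t ^ (-1 - 2 * s)) * h2
  refine ⟨?_, ?_⟩
  · refine IntegrableOn.congr_fun ?_ heq measurableSet_Ioi
    exact ((integrableOn_Ioi_comp_mul_left_iff (fun t => h t * t ^ (-1 - 2 * s)) ε hk0).2
      hint).const_mul _
  · rw [← setIntegral_congr_fun measurableSet_Ioi heq, integral_const_mul,
      integral_comp_mul_left_Ioi (fun t => h t * t ^ (-1 - 2 * s)) ε hk0, smul_eq_mul,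
      ← mul_assoc, ← Real.rpow_neg_one, ← Real.rpow_add hk0]
    ring_nf

open Asymptotics in
/-- If the tail integrals of an even function `h` against `t^(-1-2s)` are `η^(-2s)` times an even
average of an analytic function, then the hypersingular integral of its differences vanishes. -/
lemma integral_fd_eq_zero {m : ℕ} {s : ℝ} (hs : 0 < s) (hm : s < m) {h : ℝ → ℝ}
    (heven : ∀ t, h (-t) = h t) {Ψ : ℝ × ℝ → ℝ} (hΨ : AnalyticAt ℝ Ψ 0)
    (hΨe : ∀ w, Ψ (-w) = Ψ w)
    (htail : ∀ᶠ η in nhdsWithin (0 : ℝ) (Set.Ioi 0),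
      IntegrableOn (fun t => h t * t ^ (-1 - 2 * s)) (Set.Ioi η) ∧
      ∫ t in Set.Ioi η, h t * t ^ (-1 - 2 * s) =
        η ^ (-2 * s) * ∫ σ in (0 : ℝ)..1, Ψ (η, σ * η)) :
    ∫ t in Set.Ioi (0 : ℝ), (∑ k ∈ Finset.Icc (-(m : ℤ)) m, fdCoeff m k * h (k * t)) *
      t ^ (-1 - 2 * s) = 0 := by
  by_cases hI : IntegrableOn (fun t => (∑ k ∈ Finset.Icc (-(m : ℤ)) m, fdCoeff m k * h (k * t)) *
      t ^ (-1 - 2 * s)) (Set.Ioi 0)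
  swap
  · exact integral_undef hI
  set G : ℝ → ℝ := fun η => ∫ σ in (0 : ℝ)..1, Ψ (η, σ * η) with hG
  have hGe : ∀ η, G (-η) = G η := by
    intro η
    simp only [hG]
    congr 1 with σ
    rw [← hΨe (η, σ * η), Prod.neg_mk, mul_neg]
  set κ : ℝ := fdCoeff m 0 * (h 0 / (2 * s) - G 0) with hκ
  set S : ℝ → ℝ := fun ε => ∑ k ∈ Finset.Icc (-(m : ℤ)) m, fdCoeff m k * G (k * ε) with hS
  set T : ℝ → ℝ := fun ε => ∫ t in Set.Ioi ε,
    (∑ k ∈ Finset.Icc (-(m : ℤ)) m, fdCoeff m k * h (k * t)) * t ^ (-1 - 2 * s) with hT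
  have hSO : S =O[nhds 0] fun ε => ε ^ (2 * m) := sum_fdCoeff_integral_isBigO m hΨ
  have hTI : Tendsto T (nhdsWithin 0 (Set.Ioi 0)) (nhds (∫ t in Set.Ioi (0 : ℝ),
      (∑ k ∈ Finset.Icc (-(m : ℤ)) m, fdCoeff m k * h (k * t)) * t ^ (-1 - 2 * s))) := by
    have hc := aecover_Ioi_of_Ioi (μ := volume) (A := (0 : ℝ))
      (tendsto_id.mono_left (nhdsWithin_le_nhds (a := (0 : ℝ)) (s := Set.Ioi 0)))
    have h1 := hc.integral_tendsto_of_countably_generated hI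
    refine h1.congr' ?_
    filter_upwards [self_mem_nhdsWithin] with ε hε
    rw [hT, Measure.restrict_restrict measurableSet_Ioi, Set.inter_eq_left.2]
    · rfl
    · exact Set.Ioi_subset_Ioi (le_of_lt hε)
  have hTS : ∀ᶠ ε in nhdsWithin (0 : ℝ) (Set.Ioi 0), T ε = ε ^ (-2 * s) * (S ε + κ) := by
    obtain ⟨δ, hδ, hδ'⟩ := mem_nhdsGT_iff_exists_Ioo_subset.1 htail
    have hδm : 0 < δ / (m + 1) := div_pos hδ (by positivity)
    filter_upwards [Ioo_mem_nhdsGT hδm] with ε hε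
    have hε0 : 0 < ε := hε.1
    have hk : ∀ k ∈ Finset.Icc (-(m : ℤ)) m,
        IntegrableOn (fun t => h (k * t) * t ^ (-1 - 2 * s)) (Set.Ioi ε) ∧
        ∫ t in Set.Ioi ε, h (k * t) * t ^ (-1 - 2 * s) =
          ε ^ (-2 * s) * (G (k * ε) + if k = 0 then h 0 / (2 * s) - G 0 else 0) := by
      intro k hk
      by_cases hk0 : k = 0
      · subst hk0
        have hlt : -1 - 2 * s < -1 := by linarith
        simp only [Int.cast_zero, zero_mul, if_true, add_sub_cancel]
        refine ⟨(integrableOn_Ioi_rpow_of_lt hlt hε0).const_mul _, ?_⟩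
        rw [integral_const_mul, integral_Ioi_rpow_of_lt hlt hε0]
        ring_nf
      · have hkp : 0 < |(k : ℝ)| := abs_pos.2 (Int.cast_ne_zero.2 hk0)
        have hkm : |(k : ℝ)| ≤ m := by
          rw [Finset.mem_Icc] at hk
          rw [abs_le]
          exact ⟨by exact_mod_cast hk.1, by exact_mod_cast hk.2⟩
        have hmem : |(k : ℝ)| * ε ∈ Set.Ioo 0 δ := by
          refine ⟨mul_pos hkp hε0, ?_⟩
          have := (lt_div_iff₀ (by positivity : (0 : ℝ) < m + 1)).1 hε.2
          nlinarith [mul_le_mul_of_nonneg_right hkm hε0.le]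
        obtain ⟨h1, h2⟩ := hδ' hmem
        obtain ⟨h3, h4⟩ := fd_integrable_tail heven hk0 hε0 h1
        refine ⟨h3, ?_⟩
        have h5 : G (|(k : ℝ)| * ε) = G (k * ε) := by
          rcases abs_choice (k : ℝ) with h' | h' <;> rw [h']
          rw [neg_mul, hGe]
        have h6 : |(k : ℝ)| ^ (2 * s) * |(k : ℝ)| ^ (-2 * s) = 1 := by
          rw [← Real.rpow_add hkp]; ring_nf; simp
        change _ = _ * G (|(k : ℝ)| * ε) at h2
        rw [h4, h2, h5, if_neg hk0, Real.mul_rpow hkp.le hε0.le]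
        linear_combination (ε ^ (-2 * s) * G (k * ε)) * h6
    simp only [hT, hS, hκ, Finset.sum_mul, mul_assoc]
    rw [integral_finsetSum _ fun k hk' => ((hk k hk').1).const_mul _]
    simp only [integral_const_mul]
    rw [Finset.sum_congr rfl fun k hk' => by rw [(hk k hk').2]]
    have h0 : (0 : ℤ) ∈ Finset.Icc (-(m : ℤ)) m := by simp
    simp only [mul_add, Finset.sum_add_distrib, mul_ite, mul_zero, Finset.sum_ite_eq' _ (0 : ℤ),
      if_pos h0, Finset.mul_sum]
    rw [Finset.sum_congr rfl fun k _ => mul_left_comm _ _ _]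
    ring
  have hS0 : Tendsto (fun ε => ε ^ (-2 * s) * S ε) (nhdsWithin 0 (Set.Ioi 0)) (nhds 0) := by
    have h1 : (fun ε : ℝ => ε ^ (-2 * s) * S ε) =O[nhdsWithin 0 (Set.Ioi 0)]
        fun ε => ε ^ (-2 * s) * ε ^ (2 * m) :=
      (isBigO_refl _ _).mul (hSO.mono nhdsWithin_le_nhds)
    refine h1.trans_tendsto ?_
    have hpos : 0 < 2 * (m : ℝ) - 2 * s := by linarith
    have h2 : Tendsto (fun ε : ℝ => ε ^ (2 * (m : ℝ) - 2 * s)) (nhdsWithin 0 (Set.Ioi 0))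
        (nhds 0) := by
      have := (Real.continuousAt_rpow_const 0 (2 * (m : ℝ) - 2 * s) (Or.inr hpos.le)).tendsto
      rw [Real.zero_rpow hpos.ne'] at this
      exact this.mono_left nhdsWithin_le_nhds
    refine h2.congr' ?_
    filter_upwards [self_mem_nhdsWithin] with ε hε
    rw [← Real.rpow_natCast, ← Real.rpow_add hε]
    push_cast
    ring_nf
  have hε2 : Tendsto (fun ε : ℝ => ε ^ (2 * s)) (nhdsWithin 0 (Set.Ioi 0)) (nhds 0) := by
    have := (Real.continuousAt_rpow_const 0 (2 * s) (Or.inr (by positivity))).tendsto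
    rw [Real.zero_rpow (by positivity)] at this
    exact this.mono_left nhdsWithin_le_nhds
  have hκ0 : κ = 0 := by
    have h1 := (hε2.mul (hTI.sub hS0))
    rw [zero_mul] at h1
    refine tendsto_nhds_unique (tendsto_const_nhds.congr' ?_) h1
    filter_upwards [hTS, self_mem_nhdsWithin] with ε hε hε0
    have h6 : ε ^ (2 * s) * ε ^ (-2 * s) = 1 := by
      rw [← Real.rpow_add hε0]; ring_nf; simp
    rw [hε]
    linear_combination (-κ) * h6
  refine tendsto_nhds_unique hTI (hS0.congr' ?_)
  filter_upwards [hTS] with ε hε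
  rw [hε, hκ0, add_zero]

lemma exists_add_pow_eq (p : ℝ) (i : ℕ) : ∃ U V : Polynomial ℝ, U.natDegree * 2 ≤ i ∧
    V.natDegree * 2 ≤ i - 1 ∧ ∀ q : ℝ, (q + p) ^ i = U.eval (q ^ 2) + q * V.eval (q ^ 2) := by
  induction i with
  | zero => exact ⟨1, 0, by simp, by simp, by simp⟩
  | succ i ih =>
    obtain ⟨U, V, hU, hV, h⟩ := ih
    by_cases hi : i = 0
    · subst hi
      exact ⟨Polynomial.C p, 1, by simp, by simp, fun q => by simp; ring⟩
    refine ⟨Polynomial.C p * U + Polynomial.X * V, U + Polynomial.C p * V, ?_, ?_, fun q => ?_⟩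
    · have h1 := Polynomial.natDegree_C_mul_le p U
      have h2 := Polynomial.natDegree_mul_le (p := Polynomial.X) (q := V)
      have h3 := Polynomial.natDegree_add_le (Polynomial.C p * U) (Polynomial.X * V)
      rw [Polynomial.natDegree_X] at h2
      omega
    · have h1 := Polynomial.natDegree_C_mul_le p V
      have h3 := Polynomial.natDegree_add_le U (Polynomial.C p * V)
      omega
    · rw [pow_succ, h]
      simp only [Polynomial.eval_add, Polynomial.eval_mul, Polynomial.eval_C, Polynomial.eval_X]
      ring

/-- The odd part of `(q + p)^(2l+1)` is `q` times a polynomial of degree at most `l` in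
`C q² - ρ`. -/
lemma exists_odd_part_eq (p ρ : ℝ) {C : ℝ} (hC : C ≠ 0) (l : ℕ) : ∃ d : ℕ → ℝ, ∀ q : ℝ,
    (q + p) ^ (2 * l + 1) + (q - p) ^ (2 * l + 1) =
      ∑ j ∈ Finset.range (l + 1), d j * (q * (C * q ^ 2 - ρ) ^ j) := by
  obtain ⟨U, V, -, hV, h⟩ := exists_add_pow_eq p (2 * l + 1)
  set N := V.comp (Polynomial.C C⁻¹ * (Polynomial.X + Polynomial.C ρ)) with hN
  have hdeg : N.natDegree < l + 1 := by
    have h1 := Polynomial.natDegree_comp_le (p := V)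
      (q := Polynomial.C C⁻¹ * (Polynomial.X + Polynomial.C ρ))
    have h2 : (Polynomial.C C⁻¹ * (Polynomial.X + Polynomial.C ρ)).natDegree ≤ 1 :=
      (Polynomial.natDegree_C_mul_le _ _).trans (by simp)
    have h3 := Nat.mul_le_mul_left V.natDegree h2
    rw [← hN] at h1
    omega
  refine ⟨fun j => 2 * N.coeff j, fun q => ?_⟩
  have h1 : V.eval (q ^ 2) = N.eval (C * q ^ 2 - ρ) := by
    rw [hN, Polynomial.eval_comp]
    congr 1
    simp [hC]
  have h2 : (q - p) ^ (2 * l + 1) = -(-q + p) ^ (2 * l + 1) := by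
    rw [← Odd.neg_pow ⟨l, rfl⟩]; ring_nf
  rw [h2, h, h, neg_sq, h1, Polynomial.eval_eq_sum_range' hdeg]
  simp only [mul_assoc, ← Finset.mul_sum, mul_left_comm _ q]
  ring

lemma radial_factor {C ρ : ℝ} (hC : 0 < C) (hρ : 0 < ρ) (q : ℝ) :
    C * q ^ 2 - ρ = C * ((q - √(ρ / C)) * (q + √(ρ / C))) := by
  have := Real.sq_sqrt (div_nonneg hρ.le hC.le)
  have h2 : C * √(ρ / C) ^ 2 = ρ := by rw [this]; field_simp
  linear_combination h2

lemma radial_pos {C ρ : ℝ} (hC : 0 < C) (hρ : 0 < ρ) {q : ℝ} (hq : √(ρ / C) < q) :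
    0 < C * q ^ 2 - ρ := by
  have h0 := Real.sqrt_nonneg (ρ / C)
  rw [radial_factor hC hρ]
  exact mul_pos hC (mul_pos (sub_pos.2 hq) (by linarith))

lemma radial_intervalIntegrable {C ρ β : ℝ} (hC : 0 < C) (hρ : 0 < ρ) (hβ : -1 < β)
    {φ : ℝ → ℝ} (hφ : Continuous φ) {X : ℝ} (hX : √(ρ / C) ≤ X) :
    IntervalIntegrable (fun q => (C * q ^ 2 - ρ) ^ β * φ q) volume (√(ρ / C)) X := by
  have h0 : 0 < √(ρ / C) := Real.sqrt_pos.2 (div_pos hρ hC)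
  have h1 : IntervalIntegrable (fun q => (q - √(ρ / C)) ^ β) volume (√(ρ / C)) X := by
    have := (intervalIntegral.intervalIntegrable_rpow' (a := 0) (b := X - √(ρ / C)) hβ).comp_sub_right
      (√(ρ / C))
    simpa using this
  have h2 : ContinuousOn (fun q => C ^ β * (q + √(ρ / C)) ^ β * φ q)
      (Set.uIcc (√(ρ / C)) X) := by
    rw [Set.uIcc_of_le hX]
    refine (continuousOn_const.mul (ContinuousOn.rpow_const (by fun_prop) fun q hq => ?_)).mul
      hφ.continuousOn
    exact Or.inl (by linarith [hq.1])
  refine (h1.mul_continuousOn h2).congr fun q hq => ?_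
  rw [Set.uIoc_of_le hX] at hq
  rw [radial_factor hC hρ, Real.mul_rpow hC.le
    (mul_nonneg (by linarith [hq.1]) (by linarith [hq.1])), Real.mul_rpow
    (by linarith [hq.1]) (by linarith [hq.1])]
  ring

lemma integral_radial_pow {C ρ β : ℝ} (hC : 0 < C) (hρ : 0 < ρ) (hβ : -1 < β) (j : ℕ) {X : ℝ}
    (hX : √(ρ / C) ≤ X) :
    ∫ q in √(ρ / C)..X, (C * q ^ 2 - ρ) ^ β * (q * (C * q ^ 2 - ρ) ^ j) =
      (C * X ^ 2 - ρ) ^ (β + 1 + j) / (2 * C * (β + 1 + j)) := by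
  have hj : (0 : ℝ) ≤ j := j.cast_nonneg
  have hb : 0 < β + 1 + j := by linarith
  have h0 : 0 < √(ρ / C) := Real.sqrt_pos.2 (div_pos hρ hC)
  have hF := intervalIntegral.integral_eq_sub_of_hasDerivAt_of_le hX
    (f := fun q => (C * q ^ 2 - ρ) ^ (β + 1 + j) / (2 * C * (β + 1 + j)))
    (f' := fun q => (C * q ^ 2 - ρ) ^ β * (q * (C * q ^ 2 - ρ) ^ j))
    ((ContinuousOn.rpow_const (by fun_prop) fun q _ => Or.inr hb.le).div_const _) ?_
    (radial_intervalIntegrable hC hρ hβ (by fun_prop) hX)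
  · rw [hF, radial_factor hC hρ √(ρ / C), sub_self, zero_mul, mul_zero, Real.zero_rpow hb.ne',
      zero_div, sub_zero]
  · intro q hq
    have hR := radial_pos hC hρ hq.1
    have h1 : HasDerivAt (fun q : ℝ => C * q ^ 2 - ρ) (C * (2 * q)) q := by
      simpa using ((hasDerivAt_pow 2 q).const_mul C).sub_const ρ
    have h2 := (h1.rpow_const (p := β + 1 + j) (Or.inl hR.ne')).div_const (2 * C * (β + 1 + j))
    refine h2.congr_deriv ?_
    have h3 : β + 1 + j - 1 = β + j := by ring
    rw [h3, Real.rpow_add hR, Real.rpow_natCast]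
    field_simp

lemma tail_eq_radial {C ρ β s p : ℝ} (hC : 0 < C) (hp : C * p ^ 2 < ρ) (hβ : -1 < β) (hβ0 : β ≠ 0)
    {l : ℕ} (hs : s = β + (l + 1)) {η : ℝ} (hη : 0 < η) (hηp : √(ρ / C) ≤ η⁻¹ - p) :
    IntegrableOn (fun t => max 0 (C - 2 * C * p * t - (ρ - C * p ^ 2) * t ^ 2) ^ β *
      t ^ (-1 - 2 * s)) (Set.Ioi η) ∧
    ∫ t in Set.Ioi η, max 0 (C - 2 * C * p * t - (ρ - C * p ^ 2) * t ^ 2) ^ β *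
      t ^ (-1 - 2 * s) =
      ∫ q in √(ρ / C)..(η⁻¹ - p), (C * q ^ 2 - ρ) ^ β * (q + p) ^ (2 * l + 1) := by
  have hρ : 0 < ρ := lt_of_le_of_lt (by positivity) hp
  set q₁ := √(ρ / C) with hq₁
  have hpq : |p| < q₁ := by
    rw [hq₁, Real.lt_sqrt (abs_nonneg p), sq_abs, lt_div_iff₀ hC]
    linarith
  obtain ⟨hp1, hp2⟩ := abs_lt.1 hpq
  set f : ℝ → ℝ := fun t => max 0 (C - 2 * C * p * t - (ρ - C * p ^ 2) * t ^ 2) ^ β *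
      t ^ (-1 - 2 * s) with hf
  have himg : (fun q : ℝ => (q + p)⁻¹) '' Set.Ioo q₁ (η⁻¹ - p) = Set.Ioo η (q₁ + p)⁻¹ := by
    ext t
    constructor
    · rintro ⟨q, hq, rfl⟩
      have hz : 0 < q + p := by linarith [hq.1]
      refine ⟨?_, ?_⟩
      · rw [lt_inv_comm₀ hη hz]; linarith [hq.2]
      · exact (inv_lt_inv₀ hz (by linarith)).2 (by linarith [hq.1])
    · rintro ⟨h1, h2⟩
      have ht : 0 < t := hη.trans h1
      refine ⟨t⁻¹ - p, ⟨?_, ?_⟩, by simp⟩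
      · have := (lt_inv_comm₀ ht (by linarith)).1 h2
        linarith
      · have := (inv_lt_inv₀ ht hη).2 h1
        linarith
  have hsub : Set.Ioo η (q₁ + p)⁻¹ ⊆ Set.Ioi η := Set.Ioo_subset_Ioi_self
  have hzero : ∀ t ∈ Set.Ioi η \ Set.Ioo η (q₁ + p)⁻¹, f t = 0 := by
    rintro t ⟨ht, ht'⟩
    have ht0 : 0 < t := hη.trans ht
    have h1 : (q₁ + p)⁻¹ ≤ t := by
      by_contra h
      exact ht' ⟨ht, not_le.1 h⟩
    have h2 : t⁻¹ - p ≤ q₁ := by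
      have := (inv_le_comm₀ (by linarith) ht0).1 h1
      linarith
    have h3 : -q₁ ≤ t⁻¹ - p := by linarith [inv_pos.2 ht0]
    have h4 : C - 2 * C * p * t - (ρ - C * p ^ 2) * t ^ 2 = t ^ 2 * (C * (t⁻¹ - p) ^ 2 - ρ) := by
      field_simp; ring
    have h5 : C * (t⁻¹ - p) ^ 2 - ρ ≤ 0 := by
      rw [radial_factor hC hρ]
      exact mul_nonpos_of_nonneg_of_nonpos hC.le
        (mul_nonpos_of_nonpos_of_nonneg (by linarith) (by linarith))
    simp only [hf]
    rw [h4, max_eq_left (mul_nonpos_of_nonneg_of_nonpos (by positivity) h5), Real.zero_rpow hβ0,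
      zero_mul]
  have hderiv : ∀ q ∈ Set.Ioo q₁ (η⁻¹ - p), HasDerivWithinAt (fun q : ℝ => (q + p)⁻¹)
      (-1 / (q + p) ^ 2) (Set.Ioo q₁ (η⁻¹ - p)) q := fun q hq =>
    (((hasDerivAt_id q).add_const p).inv (by simp only [id]; linarith [hq.1])).hasDerivWithinAt
  have hinj : Set.InjOn (fun q : ℝ => (q + p)⁻¹) (Set.Ioo q₁ (η⁻¹ - p)) :=
    fun a _ b _ hab => add_right_cancel (inv_injective hab)
  have hcongr : Set.EqOn (fun q => (C * q ^ 2 - ρ) ^ β * (q + p) ^ (2 * l + 1))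
      (fun q => |-1 / (q + p) ^ 2| • f (q + p)⁻¹) (Set.Ioo q₁ (η⁻¹ - p)) := by
    intro q hq
    have hz : 0 < q + p := by linarith [hq.1]
    have hR := radial_pos hC hρ hq.1
    have h4 : C - 2 * C * p * (q + p)⁻¹ - (ρ - C * p ^ 2) * (q + p)⁻¹ ^ 2 =
        (C * q ^ 2 - ρ) * (q + p) ^ (-2 : ℝ) := by
      rw [Real.rpow_neg hz.le, Real.rpow_two]
      field_simp; ring
    have h5 : |-1 / (q + p) ^ 2| = (q + p) ^ (-2 : ℝ) := by
      rw [abs_div, abs_neg, abs_one, abs_of_pos (by positivity), Real.rpow_neg hz.le,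
        Real.rpow_two, one_div]
    simp only [hf, smul_eq_mul]
    rw [h4, h5, max_eq_right (by positivity), Real.mul_rpow hR.le (by positivity),
      ← Real.rpow_mul hz.le, Real.inv_rpow hz.le, ← Real.rpow_neg hz.le]
    have h6 : (q + p) ^ (((2 * l + 1 : ℕ)) : ℝ) = (q + p) ^ (-2 : ℝ) *
        ((q + p) ^ (-2 * β) * (q + p) ^ (-(-1 - 2 * s))) := by
      rw [← Real.rpow_add hz, ← Real.rpow_add hz, hs]
      congr 1
      push_cast
      ring
    rw [Real.rpow_natCast] at h6
    rw [h6]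
    ring
  have hint := (intervalIntegrable_iff_integrableOn_Ioo_of_le hηp).1
    (radial_intervalIntegrable hC hρ hβ (φ := fun q => (q + p) ^ (2 * l + 1)) (by fun_prop) hηp)
  refine ⟨?_, ?_⟩
  · refine IntegrableOn.of_forall_sdiff_eq_zero (s := Set.Ioo η (q₁ + p)⁻¹) ?_ measurableSet_Ioi hzero
    rw [← himg, integrableOn_image_iff_integrableOn_abs_deriv_smul measurableSet_Ioo hderiv hinj]
    exact hint.congr_fun hcongr measurableSet_Ioo
  · rw [setIntegral_eq_of_subset_of_forall_sdiff_eq_zero measurableSet_Ioi hsub hzero, ← himg,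
      integral_image_eq_integral_abs_deriv_smul measurableSet_Ioo hderiv hinj,
      intervalIntegral.integral_of_le hηp, integral_Ioc_eq_integral_Ioo]
    exact (setIntegral_congr_fun measurableSet_Ioo hcongr).symm

/-- The rescaled integrand of the radial integral over a strip of width `p`. -/
def stripFun (C ρ β p : ℝ) (l : ℕ) (w : ℝ × ℝ) : ℝ :=
  p * w.1 * ((C * (1 - p * w.2) ^ 2 - ρ * w.1 ^ 2) ^ β * (1 + p * w.1 - p * w.2) ^ (2 * l + 1))

lemma stripFun_neg (C ρ β p : ℝ) (l : ℕ) (w : ℝ × ℝ) :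
    stripFun C ρ β (-p) l w = stripFun C ρ β p l (-w) := by
  simp [stripFun]

lemma analyticAt_stripFun {C : ℝ} (hC : 0 < C) (ρ β p : ℝ) (l : ℕ) :
    AnalyticAt ℝ (stripFun C ρ β p l) 0 := by
  refine ContDiffAt.analyticAt ?_
  unfold stripFun
  refine ContDiffAt.mul (by fun_prop) (ContDiffAt.mul (ContDiffAt.rpow_const_of_ne (by fun_prop) ?_)
    (by fun_prop))
  simp [hC.ne']

lemma integral_strip {C ρ β s p : ℝ} (hC : 0 < C) (hρ : 0 < ρ) {l : ℕ} (hs : s = β + (l + 1))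
    {η : ℝ} (hη : 0 < η) (hηp : √(ρ / C) + |p| < η⁻¹) :
    IntervalIntegrable (fun σ => stripFun C ρ β p l (η, σ * η)) volume 0 1 ∧
    ∫ q in (η⁻¹ - p)..η⁻¹, (C * q ^ 2 - ρ) ^ β * (q + p) ^ (2 * l + 1) =
      η ^ (-2 * s) * ∫ σ in (0 : ℝ)..1, stripFun C ρ β p l (η, σ * η) := by
  have hbase : ∀ σ ∈ Set.Icc (0 : ℝ) 1, 0 < C * (η⁻¹ - p * σ) ^ 2 - ρ := by
    intro σ hσ
    refine radial_pos hC hρ ?_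
    have : p * σ ≤ |p| := by
      refine (le_abs_self _).trans ?_
      rw [abs_mul, abs_of_nonneg hσ.1]
      exact mul_le_of_le_one_right (abs_nonneg _) hσ.2
    linarith
  have heq : ∀ σ : ℝ, C * (1 - p * (σ * η)) ^ 2 - ρ * η ^ 2 =
      η ^ 2 * (C * (η⁻¹ - p * σ) ^ 2 - ρ) := by
    intro σ; field_simp
  refine ⟨?_, ?_⟩
  · refine ContinuousOn.intervalIntegrable_of_Icc zero_le_one ?_
    simp only [stripFun]
    refine ContinuousOn.mul (by fun_prop) (ContinuousOn.mul (ContinuousOn.rpow_const (by fun_prop)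
      fun σ hσ => Or.inl ?_) (by fun_prop))
    rw [heq]
    exact (mul_pos (by positivity) (hbase σ hσ)).ne'
  · have h1 := intervalIntegral.smul_integral_comp_sub_mul
      (fun q => (C * q ^ 2 - ρ) ^ β * (q + p) ^ (2 * l + 1)) (a := 0) (b := 1) p η⁻¹
    rw [mul_one, mul_zero, sub_zero] at h1
    rw [← h1, smul_eq_mul, ← intervalIntegral.integral_const_mul,
      ← intervalIntegral.integral_const_mul]
    refine intervalIntegral.integral_congr fun σ hσ => ?_
    rw [Set.uIcc_of_le zero_le_one] at hσ
    have h2 : 1 + p * η - p * (σ * η) = η * (η⁻¹ - p * σ + p) := by field_simp; ring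
    have h3 : η ^ (-2 * s) * (η * ((η ^ 2) ^ β * η ^ (2 * l + 1))) = 1 := by
      rw [← Real.rpow_natCast η 2, ← Real.rpow_natCast η (2 * l + 1), ← Real.rpow_mul hη.le]
      nth_rewrite 2 [← Real.rpow_one η]
      rw [← Real.rpow_add hη, ← Real.rpow_add hη, ← Real.rpow_add hη, hs]
      push_cast
      ring_nf
      simp
    simp only [stripFun]
    rw [heq, h2, Real.mul_rpow (by positivity) (hbase σ hσ).le, mul_pow]
    linear_combination (-(p * ((C * (η⁻¹ - p * σ) ^ 2 - ρ) ^ β *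
      (η⁻¹ - p * σ + p) ^ (2 * l + 1)))) * h3

lemma exists_tail_eq {C ρ β s p : ℝ} (hC : 0 < C) (hp : C * p ^ 2 < ρ) (hβ : -1 < β) (hβ0 : β ≠ 0)
    {l : ℕ} (hs : s = β + (l + 1)) {g : ℝ → ℝ}
    (hg : ∀ t, g t = max 0 (C - 2 * C * p * t - (ρ - C * p ^ 2) * t ^ 2) ^ β) :
    ∃ Ψ : ℝ × ℝ → ℝ, AnalyticAt ℝ Ψ 0 ∧ (∀ w, Ψ (-w) = Ψ w) ∧
      ∀ᶠ η in nhdsWithin (0 : ℝ) (Set.Ioi 0),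
        IntegrableOn (fun t => (g t + g (-t)) * t ^ (-1 - 2 * s)) (Set.Ioi η) ∧
        ∫ t in Set.Ioi η, (g t + g (-t)) * t ^ (-1 - 2 * s) =
          η ^ (-2 * s) * ∫ σ in (0 : ℝ)..1, Ψ (η, σ * η) := by
  have hρ : 0 < ρ := lt_of_le_of_lt (by positivity) hp
  obtain ⟨d, hd⟩ := exists_odd_part_eq p ρ hC.ne' l
  set e : ℝ → ℝ := fun u => ∑ j ∈ Finset.range (l + 1),
    d j / (2 * C * (β + 1 + j)) * ((C - ρ * u ^ 2) ^ (β + 1 + j) * u ^ (2 * (l - j))) with he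
  refine ⟨fun w => e w.1 - stripFun C ρ β p l w - stripFun C ρ β (-p) l w, ?_, ?_, ?_⟩
  · refine AnalyticAt.sub (AnalyticAt.sub ?_ (analyticAt_stripFun hC _ _ _ _))
      (analyticAt_stripFun hC _ _ _ _)
    refine ContDiffAt.analyticAt ?_
    refine ContDiffAt.sum fun j _ => ContDiffAt.mul (by fun_prop)
      (ContDiffAt.mul (ContDiffAt.rpow_const_of_ne (by fun_prop) ?_) (by fun_prop))
    simp [hC.ne']
  · intro w
    have : e (-w).1 = e w.1 := by
      simp only [he, Prod.fst_neg, neg_sq, pow_mul]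
    simp only [this, stripFun_neg, neg_neg]
    ring
  have hδ : 0 < (√(ρ / C) + |p| + 1)⁻¹ := by positivity
  filter_upwards [Ioo_mem_nhdsGT hδ] with η ⟨hη, hη'⟩
  have hY : √(ρ / C) + |p| < η⁻¹ := by
    have := (lt_inv_comm₀ hη (by positivity)).1 hη'
    linarith
  have hY' : √(ρ / C) + |-p| < η⁻¹ := by rwa [abs_neg]
  have hple := le_abs_self p
  have hnple := neg_abs_le p
  have hY0 : √(ρ / C) ≤ η⁻¹ := by linarith [abs_nonneg p]
  obtain ⟨i1, t1⟩ := tail_eq_radial hC hp hβ hβ0 hs hη (by linarith)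
  obtain ⟨i2, t2⟩ := tail_eq_radial (p := -p) hC (by rwa [neg_sq]) hβ hβ0 hs hη (by linarith)
  obtain ⟨j1, s1⟩ := integral_strip hC hρ hs hη hY
  obtain ⟨j2, s2⟩ := integral_strip (p := -p) hC hρ hs hη hY'
  have hg1 : (fun t => max 0 (C - 2 * C * p * t - (ρ - C * p ^ 2) * t ^ 2) ^ β *
      t ^ (-1 - 2 * s)) = fun t => g t * t ^ (-1 - 2 * s) := by
    funext t; rw [hg]
  have hg2 : (fun t => max 0 (C - 2 * C * (-p) * t - (ρ - C * (-p) ^ 2) * t ^ 2) ^ β *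
      t ^ (-1 - 2 * s)) = fun t => g (-t) * t ^ (-1 - 2 * s) := by
    funext t; rw [hg]; ring_nf
  rw [hg1] at i1 t1
  rw [hg2] at i2 t2
  simp only [add_mul]
  refine ⟨i1.add i2, ?_⟩
  have r1 : ∀ {p X : ℝ}, √(ρ / C) ≤ X →
      IntervalIntegrable (fun q => (C * q ^ 2 - ρ) ^ β * (q + p) ^ (2 * l + 1)) volume
        (√(ρ / C)) X := fun hX =>
    radial_intervalIntegrable hC hρ hβ (by fun_prop) hX
  have a1 := intervalIntegral.integral_interval_sub_left (r1 (p := p) hY0)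
    (r1 (p := p) (X := η⁻¹ - p) (by linarith))
  have a2 := intervalIntegral.integral_interval_sub_left (r1 (p := -p) hY0)
    (r1 (p := -p) (X := η⁻¹ - -p) (by linarith))
  have hodd : (∫ q in √(ρ / C)..η⁻¹, (C * q ^ 2 - ρ) ^ β * (q + p) ^ (2 * l + 1)) +
      ∫ q in √(ρ / C)..η⁻¹, (C * q ^ 2 - ρ) ^ β * (q + -p) ^ (2 * l + 1) =
      η ^ (-2 * s) * e η := by
    rw [← intervalIntegral.integral_add (r1 hY0) (r1 hY0)]
    simp only [← mul_add, ← sub_eq_add_neg, hd, Finset.mul_sum, mul_left_comm _ (d _)]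
    rw [intervalIntegral.integral_finsetSum fun j _ =>
      (radial_intervalIntegrable hC hρ hβ (by fun_prop) hY0).const_mul _]
    simp only [intervalIntegral.integral_const_mul, he, Finset.mul_sum]
    refine Finset.sum_congr rfl fun j hj => ?_
    rw [integral_radial_pow hC hρ hβ j hY0]
    have hjl : j ≤ l := Nat.lt_succ_iff.1 (Finset.mem_range.1 hj)
    have hj0 : (0 : ℝ) ≤ j := j.cast_nonneg
    have hRY : C - ρ * η ^ 2 = η ^ 2 * (C * η⁻¹ ^ 2 - ρ) := by field_simp
    have hR0 : 0 < C * η⁻¹ ^ 2 - ρ := by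
      have := (abs_nonneg p)
      have hp0 : √(ρ / C) ≤ √(ρ / C) + |p| := by linarith
      exact radial_pos hC hρ (hp0.trans_lt hY)
    have h3 : η ^ (-2 * s) * ((η ^ 2) ^ (β + 1 + j) * η ^ (2 * (l - j))) = 1 := by
      rw [← Real.rpow_natCast η 2, ← Real.rpow_natCast η (2 * (l - j)), ← Real.rpow_mul hη.le,
        ← Real.rpow_add hη, ← Real.rpow_add hη, hs]
      push_cast [hjl]
      ring_nf
      simp
    rw [hRY, Real.mul_rpow (by positivity) hR0.le]
    linear_combination (-(d j * ((C * η⁻¹ ^ 2 - ρ) ^ (β + 1 + j) / (2 * C * (β + 1 + j))))) * h3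
  rw [integral_add i1 i2, t1, t2, intervalIntegral.integral_sub
    (intervalIntegrable_const.sub j1) j2, intervalIntegral.integral_sub intervalIntegrable_const j1]
  simp only [intervalIntegral.integral_const, sub_zero, one_smul]
  linear_combination hodd - a1 - a2 - s1 - s2

lemma integral_fd_quadratic_eq_zero {m : ℕ} {s : ℝ} (hs : 0 < s) (hm : s < m) {ℓ : ℕ} (hℓ : 1 ≤ ℓ)
    (hsl : -1 < s - ℓ) (hsl0 : s - ℓ ≠ 0) {A C : ℝ} (hA : 0 < A) (hC : 0 < C) (B : ℝ) :
    ∫ t in Set.Ioi (0 : ℝ), (∑ k ∈ Finset.Icc (-(m : ℤ)) m, fdCoeff m k *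
      max 0 (C - 2 * B * (k * t) - A * (k * t) ^ 2) ^ (s - ℓ)) * t ^ (-1 - 2 * s) = 0 := by
  obtain ⟨l, rfl⟩ := Nat.exists_eq_add_of_le' hℓ
  set g : ℝ → ℝ := fun t => max 0 (C - 2 * B * t - A * t ^ 2) ^ (s - ((l + 1 : ℕ) : ℝ)) with hg
  obtain ⟨Ψ, hΨ, hΨe, htail⟩ := exists_tail_eq (C := C) (ρ := A + C * (B / C) ^ 2) (p := B / C)
    (s := s) (l := l) (g := g) hC (by linarith) hsl hsl0 (by push_cast; ring) (fun t => by
      rw [mul_assoc 2 C, mul_div_cancel₀ B hC.ne', add_sub_cancel_right])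
  have h0 := integral_fd_eq_zero hs hm (h := fun t => g t + g (-t))
    (fun t => by rw [neg_neg, add_comm]) hΨ hΨe htail
  have hsymm : ∀ t : ℝ, ∑ k ∈ Finset.Icc (-(m : ℤ)) m, fdCoeff m k * (g (k * t) + g (-(k * t))) =
      2 * ∑ k ∈ Finset.Icc (-(m : ℤ)) m, fdCoeff m k * g (k * t) := by
    intro t
    simp only [mul_add, Finset.sum_add_distrib, two_mul]
    congr 1
    rw [← sum_Icc_neg_comp m fun k : ℤ => fdCoeff m k * g (k * t)]
    refine Finset.sum_congr rfl fun k hk => ?_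
    rw [fdCoeff_neg hk, Int.cast_neg, neg_mul]
  simp only [hsymm, mul_assoc] at h0
  rw [integral_const_mul] at h0
  exact (mul_eq_zero.1 h0).resolve_left two_ne_zero

lemma integral_eq_zero_of_forall_sphere {E : Type*} [NormedAddCommGroup E] [NormedSpace ℝ E]
    [Nontrivial E] [FiniteDimensional ℝ E] [MeasurableSpace E] [BorelSpace E] (μ : Measure E)
    [μ.IsAddHaarMeasure] {f : E → ℝ}
    (hf : ∀ θ ∈ Metric.sphere (0 : E) 1,
      ∫ r in Set.Ioi (0 : ℝ), r ^ (Module.finrank ℝ E - 1) * f (r • θ) = 0) :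
    ∫ y, f y ∂μ = 0 := by
  by_cases hfi : Integrable f μ
  swap
  · exact integral_undef hfi
  set F : Metric.sphere (0 : E) 1 × Set.Ioi (0 : ℝ) → ℝ := fun q => f (q.2.1 • q.1.1) with hF
  have hFc : ∀ x : ({0}ᶜ : Set E), F (homeomorphUnitSphereProd E x) = f x := by
    intro x
    have hx : ‖x.1‖ ≠ 0 := norm_ne_zero_iff.2 x.2
    simp [hF, smul_smul, hx]
  have hmp := μ.measurePreserving_homeomorphUnitSphereProd
  have hemb := (homeomorphUnitSphereProd E).measurableEmbedding
  have h1 : ∫ y, f y ∂μ = ∫ q, F q ∂μ.toSphere.prod (.volumeIoiPow (Module.finrank ℝ E - 1)) := by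
    rw [← hmp.integral_comp hemb]
    simp only [hFc]
    rw [integral_subtype_comap (measurableSet_singleton _).compl f, restrict_compl_singleton]
  have h2 : Integrable F (μ.toSphere.prod (.volumeIoiPow (Module.finrank ℝ E - 1))) := by
    rw [← hmp.integrable_comp_emb hemb]
    simp only [Function.comp_def, hFc]
    have := (integrableOn_iff_comap_subtypeVal (μ := μ) (f := f)
      (measurableSet_singleton (0 : E)).compl).1 hfi.integrableOn
    exact this
  rw [h1, integral_prod _ h2]
  refine integral_eq_zero_of_ae (.of_forall fun θ => ?_)
  simp only [Measure.volumeIoiPow, ENNReal.ofReal, hF, Pi.zero_apply]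
  rw [integral_withDensity_eq_integral_smul (measurable_subtype_coe.pow_const _).real_toNNReal,
    integral_subtype_comap measurableSet_Ioi fun r : ℝ =>
      Real.toNNReal (r ^ (Module.finrank ℝ E - 1)) • f (r • θ.1)]
  refine Eq.trans ?_ (hf θ.1 θ.2)
  refine setIntegral_congr_fun measurableSet_Ioi fun r hr => ?_
  simp only [NNReal.smul_def, smul_eq_mul]
  rw [Real.coe_toNNReal _ (pow_nonneg hr.out.le _)]

lemma qa_pos {n : ℕ} {a : Fin n → ℝ} (ha : ∀ i, 0 < a i) {θ : EuclideanSpace ℝ (Fin n)}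
    (hθ : θ ≠ 0) : 0 < qa n a θ := by
  obtain ⟨i, hi⟩ : ∃ i, θ i ≠ 0 := by
    by_contra! h
    exact hθ (by ext i; simpa using h i)
  exact Finset.sum_pos' (fun j _ => mul_nonneg (ha j).le (sq_nonneg _))
    ⟨i, Finset.mem_univ i, mul_pos (ha i) (by positivity)⟩

lemma qa_add_smul (n : ℕ) (a : Fin n → ℝ) (x θ : EuclideanSpace ℝ (Fin n)) (t : ℝ) :
    qa n a (x + t • θ) = qa n a x + 2 * aInner n a x θ * t + qa n a θ * t ^ 2 := by
  simp only [qa, aInner, Finset.mul_sum, Finset.sum_mul, ← Finset.sum_add_distrib,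
    PiLp.add_apply, PiLp.smul_apply, smul_eq_mul]
  exact Finset.sum_congr rfl fun i _ => by ring

lemma finDiff_uPow_smul (n m : ℕ) (a : Fin n → ℝ) (β : ℝ) (x θ : EuclideanSpace ℝ (Fin n)) (r : ℝ) :
    finDiff n m (uPow n a β) x (r • θ) = ∑ k ∈ Finset.Icc (-(m : ℤ)) m, fdCoeff m k *
      max 0 (1 - qa n a x - 2 * aInner n a x θ * (k * r) - qa n a θ * (k * r) ^ 2) ^ β := by
  refine Finset.sum_congr rfl fun k _ => ?_
  rw [uPow, smul_smul, qa_add_smul, fdCoeff]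
  congr 3
  ring

lemma finDiff_uPow_zero {n m : ℕ} (hm : 0 < m) (a : Fin n → ℝ) (x y : EuclideanSpace ℝ (Fin n)) :
    finDiff n m (uPow n a 0) x y = 0 := by
  have h := sum_fdCoeff_mul_pow (m := m) (i := 0) (by omega)
  simpa [finDiff, uPow, fdCoeff] using h

/-- the functions `u_{s-ℓ}` are pointwise `s`-harmonic in `E_a`. -/
theorem statement2 (n m ℓ : ℕ) (s : ℝ) (hn : 2 ≤ n) (hs : 0 < s) (hm : s < m)
    (hℓ : 1 ≤ ℓ) (hsl : -1 < s - (ℓ : ℝ)) (a : Fin n → ℝ) (ha : ∀ i, 0 < a i) :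
    ∀ x ∈ Ea n a, Lms n m s (uPow n a (s - (ℓ : ℝ))) x = 0 := by
  intro x hx
  rw [Lms]
  refine mul_eq_zero_of_right _ ?_
  by_cases hβ : s - (ℓ : ℝ) = 0
  · have hm0 : 0 < m := by exact_mod_cast hs.trans hm
    simp [hβ, finDiff_uPow_zero hm0]
  have : Nontrivial (Fin n) := Fin.nontrivial_iff_two_le.2 hn
  refine integral_eq_zero_of_forall_sphere _ fun θ hθ => ?_
  have hθ1 : ‖θ‖ = 1 := by simpa using hθ
  have hθ0 : θ ≠ 0 := norm_ne_zero_iff.1 (by rw [hθ1]; exact one_ne_zero)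
  refine Eq.trans ?_ (integral_fd_quadratic_eq_zero hs hm hℓ hsl hβ (qa_pos ha hθ0)
    (sub_pos.2 hx) (aInner n a x θ))
  refine setIntegral_congr_fun measurableSet_Ioi fun r hr => ?_
  have hr0 : 0 < r := hr
  have hpow : r ^ (n - 1) / r ^ ((n : ℝ) + 2 * s) = r ^ (-1 - 2 * s) := by
    rw [← Real.rpow_natCast, ← Real.rpow_sub hr0, Nat.cast_sub (by omega), Nat.cast_one]
    congr 1
    ring
  simp only [finrank_euclideanSpace_fin]
  rw [finDiff_uPow_smul, norm_smul, hθ1, mul_one, Real.norm_of_nonneg hr0.le, ← hpow]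
  ring
end
end

section
/- Let n ≥ 2, s > 0, β > 0, m > s be an integer, a = (a_1,…,a_n) ∈ ℝ^n with a_i > 0, and i ∈ {1,…,n}. Then for every x ∈ E_a, (L_{m,s}(y ↦ y_i u_β(y)))(x) = −(1/(2(β+1)a_i)) · ∂_i (L_{m,s} u_{β+1})(x), where ∂_i denotes the partial derivative in the i-th coordinate of the function x ↦ (L_{m,s} u_{β+1})(x). -/
open MeasureTheory Finset Filter
open scoped BigOperators NNReal ENNReal FourierTransform

noncomputable section

section ForwardDifference

variable {E G : Type*} [NormedAddCommGroup E] [NormedAddCommGroup G]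

theorem hasFDerivAt_fwdDiff_iter [NormedSpace ℝ E] [NormedSpace ℝ G] {w : E → G} {w' : E → E →L[ℝ] G} {y z : E} (N : ℕ)
    (hw : ∀ k ≤ N, HasFDerivAt w (w' (z + k • y)) (z + k • y)) :
    HasFDerivAt ((fwdDiff y)^[N] w) ((fwdDiff y)^[N] w' z) z := by
  have hsum : (fwdDiff y)^[N] w = fun z => ∑ k ∈ range (N + 1),
      ((-1 : ℤ) ^ (N - k) * N.choose k) • w (z + k • y) :=
    funext fun z => fwdDiff_iter_eq_sum_shift y w N z
  rw [hsum, fwdDiff_iter_eq_sum_shift]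
  refine HasFDerivAt.fun_sum fun k hk => ?_
  have h := (hasFDerivAt_comp_add_right (k • y)).2 (hw k (by simpa [Nat.lt_succ_iff] using hk))
  simp only [← Int.cast_smul_eq_zsmul ℝ]
  exact h.const_smul _

theorem norm_fwdDiff_iter_le {w : E → G} {M : ℝ} (hw : ∀ z, ‖w z‖ ≤ M) (N : ℕ) (y z : E) :
    ‖(fwdDiff y)^[N] w z‖ ≤ 2 ^ N * M := by
  induction N generalizing z with
  | zero => simpa using hw z
  | succ N ih =>
    rw [Function.iterate_succ_apply']
    calc ‖(fwdDiff y)^[N] w (z + y) - (fwdDiff y)^[N] w z‖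
        ≤ 2 ^ N * M + 2 ^ N * M := (norm_sub_le _ _).trans (add_le_add (ih _) (ih _))
      _ = 2 ^ (N + 1) * M := by ring

theorem continuous_fwdDiff_iter_sub_smul [NormedSpace ℝ E] {w : E → G} (hw : Continuous w) (N : ℕ) (c : ℝ) (x : E) :
    Continuous fun y => (fwdDiff y)^[N] w (x - c • y) := by
  simp only [fwdDiff_iter_eq_sum_shift]
  fun_prop

/-- Near a point where `w` is `C^N`, its `N`-th forward differences are `O(‖y‖ ^ N)`. -/
theorem ContDiffAt.exists_norm_fwdDiff_iter_le {E : Type} [NormedAddCommGroup E]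
    [NormedSpace ℝ E] (N : ℕ) {G : Type} [NormedAddCommGroup G] [NormedSpace ℝ G] {w : E → G}
    {x : E} (hw : ContDiffAt ℝ N w x) :
    ∃ C ≥ (0 : ℝ), ∃ ε > (0 : ℝ), ∀ z ∈ Metric.ball x ε, ∀ y ∈ Metric.ball (0 : E) ε,
      ‖(fwdDiff y)^[N] w z‖ ≤ C * ‖y‖ ^ N := by
  induction N generalizing G with
  | zero =>
    obtain ⟨ε, hε, h⟩ := Metric.continuousAt_iff.1 hw.continuousAt 1 one_pos
    refine ⟨‖w x‖ + 1, by positivity, ε, hε, fun z hz y _ => ?_⟩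
    have h1 := h hz
    rw [dist_eq_norm] at h1
    have h2 := norm_sub_norm_le (w z) (w x)
    simp only [Function.iterate_zero, id_eq, pow_zero, mul_one]
    linarith
  | succ N ih =>
    obtain ⟨w', ⟨u, hu, hw'⟩, hcont⟩ := contDiffAt_succ_iff_hasFDerivAt.1 (by exact_mod_cast hw)
    obtain ⟨C, hC, ε, hε, hbound⟩ := ih hcont
    obtain ⟨r, hr, hru⟩ := Metric.mem_nhds_iff.1 hu
    set η := min ε r / (2 * (N + 2)) with hη
    have hmin : 0 < min ε r := lt_min hε hr
    have hη0 : 0 < η := by positivity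
    have hηm : (2 * (N + 2)) * η = min ε r := by rw [hη]; field_simp
    have hηε : 2 * η ≤ ε := le_trans (by nlinarith) (hηm.le.trans (min_le_left _ _))
    have hηr : (N + 2) * η ≤ r := le_trans (by nlinarith) (hηm.le.trans (min_le_right _ _))
    refine ⟨C, hC, η, hη0, fun z hz y hy => ?_⟩
    rw [Function.iterate_succ_apply', fwdDiff]
    rw [mem_ball_zero_iff] at hy
    rw [mem_ball_iff_norm] at hz
    have hderiv : ∀ z ∈ Metric.ball x (2 * η), HasFDerivWithinAt ((fwdDiff y)^[N] w)
        ((fwdDiff y)^[N] w' z) (Metric.ball x (2 * η)) z := fun z hz =>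
      (hasFDerivAt_fwdDiff_iter N fun k hk => hw' _ <| hru <| by
        rw [mem_ball_iff_norm] at hz ⊢
        have hky : ‖k • y‖ ≤ N * η := by
          rw [← Nat.cast_smul_eq_nsmul ℝ, norm_smul, Real.norm_natCast]
          gcongr
        calc ‖z + k • y - x‖ = ‖(z - x) + k • y‖ := by congr 1; abel
          _ ≤ ‖z - x‖ + ‖k • y‖ := norm_add_le _ _
          _ < r := by linarith).hasFDerivWithinAt
    have hzmem : z ∈ Metric.ball x (2 * η) := by
      rw [mem_ball_iff_norm]; linarith
    have hzymem : z + y ∈ Metric.ball x (2 * η) := by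
      rw [mem_ball_iff_norm]
      calc ‖z + y - x‖ = ‖(z - x) + y‖ := by congr 1; abel
        _ ≤ ‖z - x‖ + ‖y‖ := norm_add_le _ _
        _ < 2 * η := by linarith
    have h := (convex_ball x (2 * η)).norm_image_sub_le_of_norm_hasFDerivWithin_le hderiv
      (fun z hz => hbound z (Metric.ball_subset_ball hηε hz) y
        (by rw [mem_ball_zero_iff]; linarith)) hzmem hzymem
    rwa [add_sub_cancel_left, mul_assoc, ← pow_succ] at h

end ForwardDifference

theorem hasDerivAt_max_zero_rpow {p : ℝ} (hp : 0 < p) (t : ℝ) :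
    HasDerivAt (fun t : ℝ => max 0 t ^ (p + 1)) ((p + 1) * max 0 t ^ p) t := by
  have hc : ∀ {q : ℝ}, 0 < q → Continuous fun t : ℝ => max 0 t ^ q := fun hq =>
    (continuous_const.max continuous_id).rpow_const fun _ => Or.inr hq.le
  have hne : ∀ t : ℝ, t ≠ 0 →
      HasDerivAt (fun t : ℝ => max 0 t ^ (p + 1)) ((p + 1) * max 0 t ^ p) t := by
    intro t ht
    rcases ht.lt_or_gt with ht | ht
    · rw [max_eq_left ht.le, Real.zero_rpow hp.ne', mul_zero]
      refine (hasDerivAt_const t (0 : ℝ)).congr_of_eventuallyEq ?_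
      filter_upwards [gt_mem_nhds ht] with r hr
      rw [max_eq_left hr.le, Real.zero_rpow (by positivity)]
    · rw [max_eq_right ht.le]
      have h := Real.hasDerivAt_rpow_const (x := t) (p := p + 1) (Or.inl ht.ne')
      rw [add_sub_cancel_right] at h
      refine h.congr_of_eventuallyEq ?_
      filter_upwards [lt_mem_nhds ht] with r hr
      rw [max_eq_right hr.le]
  exact hasDerivAt_of_hasDerivAt_of_ne' (g := fun t => (p + 1) * max 0 t ^ p)
    (fun y hy => hne y hy) (x := 0)
    (hc (by positivity)).continuousAt ((hc hp).const_mul _).continuousAt t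

section HypersingularIntegral

theorem integrable_indicator_norm_rpow_add {E : Type*} [NormedAddCommGroup E] [NormedSpace ℝ E]
    [FiniteDimensional ℝ E] [MeasurableSpace E] [BorelSpace E] (μ : Measure E)
    [μ.IsAddHaarMeasure] {p q C C' δ : ℝ} (hd : 1 ≤ Module.finrank ℝ E)
    (hp : Module.finrank ℝ E < p) (hq : q < Module.finrank ℝ E) :
    Integrable (fun y : E => (Metric.ball (0 : E) δ).indicator (fun y => C * ‖y‖ ^ (-q)) y +
      C' * (1 + ‖y‖) ^ (-p)) μ := by
  refine Integrable.add ?_ ((integrable_one_add_norm hp).const_mul _)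
  rw [integrable_indicator_iff measurableSet_ball]
  refine integrableOn_ball_of_norm_le_rpow hd hq (C := |C|) ?_
    (Measurable.aestronglyMeasurable (by fun_prop))
  refine Eventually.of_forall fun y => ?_
  rw [norm_mul, Real.norm_eq_abs, Real.norm_of_nonneg (by positivity)]

theorem ContDiffAt.exists_integrable_bound_fwdDiff_iter {E : Type} [NormedAddCommGroup E]
    [NormedSpace ℝ E] [FiniteDimensional ℝ E] [MeasurableSpace E] [BorelSpace E] (μ : Measure E)
    [μ.IsAddHaarMeasure] (hd : 1 ≤ Module.finrank ℝ E) {G : Type}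
    [NormedAddCommGroup G] [NormedSpace ℝ G] {w : E → G} {x : E} {M p c : ℝ} {N : ℕ}
    (hw : ContDiffAt ℝ N w x) (hM : ∀ z, ‖w z‖ ≤ M) (hp : Module.finrank ℝ E < p)
    (hpN : p < Module.finrank ℝ E + N) :
    ∃ ε > (0 : ℝ), ∃ b : E → ℝ, Integrable b μ ∧ ∀ z ∈ Metric.ball x ε, ∀ y,
      ‖(‖y‖ ^ p)⁻¹ • (fwdDiff y)^[N] w (z - c • y)‖ ≤ b y := by
  obtain ⟨C, hC, r, hr, hCr⟩ := hw.exists_norm_fwdDiff_iter_le N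
  have hM0 : 0 ≤ M := (norm_nonneg _).trans (hM 0)
  have hp0 : 0 < p := lt_of_le_of_lt (Nat.cast_nonneg _) hp
  set δ := r / (2 * (1 + |c|)) with hδ
  have hδ0 : 0 < δ := by positivity
  have hδr : (1 + |c|) * δ = r / 2 := by rw [hδ]; field_simp
  refine ⟨r / 2, by positivity, _, integrable_indicator_norm_rpow_add μ (C := C)
    (C' := 2 ^ N * M * (1 / δ + 1) ^ p) (δ := δ) hd hp (q := p - N) (by linarith),
    fun z hz y => ?_⟩
  have htail : 0 ≤ 2 ^ N * M * (1 / δ + 1) ^ p * (1 + ‖y‖) ^ (-p) := by positivity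
  rw [norm_smul, norm_inv, Real.norm_of_nonneg (by positivity)]
  by_cases hy : y ∈ Metric.ball (0 : E) δ
  · rw [Set.indicator_of_mem hy]
    rw [mem_ball_zero_iff] at hy
    rcases (norm_nonneg y).eq_or_lt with h0 | h0
    · rw [← h0, Real.zero_rpow hp0.ne', inv_zero, zero_mul]
      rw [← h0] at htail
      have : (0 : ℝ) ≤ 0 ^ (-(p - N)) := Real.rpow_nonneg le_rfl _
      positivity
    · have hcy : ‖c • y‖ ≤ |c| * δ := by
        rw [norm_smul, Real.norm_eq_abs]; gcongr
      have hcδ : 0 ≤ |c| * δ := by positivity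
      have hzy : z - c • y ∈ Metric.ball x r := by
        rw [mem_ball_iff_norm] at hz ⊢
        calc ‖z - c • y - x‖ = ‖(z - x) - c • y‖ := by congr 1; abel
          _ ≤ ‖z - x‖ + ‖c • y‖ := norm_sub_le _ _
          _ < r := by nlinarith
      have hyr : y ∈ Metric.ball (0 : E) r := by
        rw [mem_ball_zero_iff]; nlinarith
      refine le_add_of_le_of_nonneg ?_ htail
      calc (‖y‖ ^ p)⁻¹ * ‖(fwdDiff y)^[N] w (z - c • y)‖
          ≤ (‖y‖ ^ p)⁻¹ * (C * ‖y‖ ^ N) := by gcongr; exact hCr _ hzy _ hyr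
        _ = C * ‖y‖ ^ (-(p - N)) := by
          rw [neg_sub, Real.rpow_sub h0, Real.rpow_natCast]; ring
  · rw [Set.indicator_of_notMem hy, zero_add]
    rw [mem_ball_zero_iff, not_lt] at hy
    have hy0 : 0 < ‖y‖ := hδ0.trans_le hy
    have hle : (1 + ‖y‖) ^ p ≤ (1 / δ + 1) ^ p * ‖y‖ ^ p := by
      rw [← Real.mul_rpow (by positivity) hy0.le]
      gcongr
      have : 1 ≤ 1 / δ * ‖y‖ := by
        rw [one_div, inv_mul_eq_div, one_le_div hδ0]; exact hy
      linarith
    rw [Real.rpow_neg (by positivity), inv_mul_eq_div, ← div_eq_mul_inv,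
      div_le_div_iff₀ (by positivity) (by positivity)]
    calc ‖(fwdDiff y)^[N] w (z - c • y)‖ * (1 + ‖y‖) ^ p
        ≤ (2 ^ N * M) * ((1 / δ + 1) ^ p * ‖y‖ ^ p) := by
          gcongr; exact norm_fwdDiff_iter_le hM _ _ _
      _ = _ := by ring

/-- Differentiation of a hypersingular integral under the integral sign. -/
theorem hasFDerivAt_integral_fwdDiff_iter {E : Type} [NormedAddCommGroup E]
    [NormedSpace ℝ E] [FiniteDimensional ℝ E] [MeasurableSpace E] [BorelSpace E] (μ : Measure E)
    [μ.IsAddHaarMeasure] (hd : 1 ≤ Module.finrank ℝ E) {v : E → ℝ} {x : E} {p c : ℝ} {N : ℕ}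
    (hv : ContDiff ℝ 1 v) (hsupp : HasCompactSupport v) (hvx : ContDiffAt ℝ (N + 1) v x)
    (hp : Module.finrank ℝ E < p) (hpN : p < Module.finrank ℝ E + N) :
    Integrable (fun y => (‖y‖ ^ p)⁻¹ • (fwdDiff y)^[N] (fderiv ℝ v) (x - c • y)) μ ∧
    HasFDerivAt (fun x => ∫ y, (‖y‖ ^ p)⁻¹ • (fwdDiff y)^[N] v (x - c • y) ∂μ)
      (∫ y, (‖y‖ ^ p)⁻¹ • (fwdDiff y)^[N] (fderiv ℝ v) (x - c • y) ∂μ) x := by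
  have hv' : Continuous (fderiv ℝ v) := (contDiff_one_iff_fderiv.1 hv).2
  have hdiff : Differentiable ℝ v := (contDiff_one_iff_fderiv.1 hv).1
  obtain ⟨M, hM⟩ := hsupp.exists_bound_of_continuous hv.continuous
  obtain ⟨M', hM'⟩ := (hsupp.fderiv (𝕜 := ℝ)).exists_bound_of_continuous hv'
  obtain ⟨ε, hε, b, hb, hbound⟩ := (hvx.of_le (by simp)).exists_integrable_bound_fwdDiff_iter
    (N := N) μ hd (c := c) hM hp hpN
  obtain ⟨ε', hε', b', hb', hbound'⟩ :=
    (hvx.fderiv_right (m := N) le_rfl).exists_integrable_bound_fwdDiff_iter μ hd (c := c) hM' hp hpN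
  have hmeas : ∀ {G : Type} [NormedAddCommGroup G] [NormedSpace ℝ G] {w : E → G},
      Continuous w → ∀ z, AEStronglyMeasurable
        (fun y => (‖y‖ ^ p)⁻¹ • (fwdDiff y)^[N] w (z - c • y)) μ := fun hw z =>
    (Measurable.aestronglyMeasurable (by fun_prop)).smul
      (continuous_fwdDiff_iter_sub_smul hw N c z).aestronglyMeasurable
  refine ⟨hb'.mono' (hmeas hv' x)
    (Eventually.of_forall (hbound' x (Metric.mem_ball_self hε'))), ?_⟩
  refine hasFDerivAt_integral_of_dominated_of_fderiv_le (Metric.ball_mem_nhds x hε')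
    (F' := fun x y => (‖y‖ ^ p)⁻¹ • (fwdDiff y)^[N] (fderiv ℝ v) (x - c • y))
    (Eventually.of_forall ((hmeas hv.continuous))) (hb.mono' (hmeas hv.continuous x)
      (Eventually.of_forall (hbound x (Metric.mem_ball_self hε)))) (hmeas hv' x)
    (Eventually.of_forall fun y z hz => hbound' z hz y) hb'
    (Eventually.of_forall fun y z _ => ?_)
  have h := hasFDerivAt_fwdDiff_iter (w := v) (w' := fderiv ℝ v) (y := y) (z := z - c • y) N
    fun k _ => (hdiff _).hasFDerivAt
  exact ((hasFDerivAt_comp_sub (c • y)).2 h).const_smul ((‖y‖ ^ p)⁻¹)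

end HypersingularIntegral

section Ellipsoid

variable {n : ℕ} (a : Fin n → ℝ)

theorem hasFDerivAt_qa (x : EuclideanSpace ℝ (Fin n)) :
    HasFDerivAt (qa n a)
      (∑ j, (2 * a j * x j) • (EuclideanSpace.proj j : EuclideanSpace ℝ (Fin n) →L[ℝ] ℝ)) x := by
  refine HasFDerivAt.fun_sum fun j _ => ?_
  have h : HasFDerivAt (fun y : EuclideanSpace ℝ (Fin n) => y j)
      (EuclideanSpace.proj j : EuclideanSpace ℝ (Fin n) →L[ℝ] ℝ) x :=
    (EuclideanSpace.proj j : EuclideanSpace ℝ (Fin n) →L[ℝ] ℝ).hasFDerivAt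
  refine ((h.pow 2).const_mul (a j)).congr_fderiv ?_
  ext y
  simp
  ring

theorem contDiff_qa : ContDiff ℝ ⊤ (qa n a) := by
  unfold qa
  fun_prop

theorem continuous_uPow {β : ℝ} (hβ : 0 < β) : Continuous (uPow n a β) :=
  (continuous_const.max (continuous_const.sub (contDiff_qa a).continuous)).rpow_const
    fun _ => Or.inr hβ.le

theorem hasFDerivAt_uPow_add_one {β : ℝ} (hβ : 0 < β) (x : EuclideanSpace ℝ (Fin n)) :
    HasFDerivAt (uPow n a (β + 1)) (∑ j, (-(2 * (β + 1)) * (a j * x j * uPow n a β x)) •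
      (EuclideanSpace.proj j : EuclideanSpace ℝ (Fin n) →L[ℝ] ℝ)) x := by
  have h := (hasDerivAt_max_zero_rpow hβ (1 - qa n a x)).comp_hasFDerivAt x
    ((hasFDerivAt_qa a x).const_sub 1)
  refine h.congr_fderiv ?_
  rw [smul_neg, Finset.smul_sum, ← Finset.sum_neg_distrib]
  refine Finset.sum_congr rfl fun j _ => ?_
  rw [smul_smul, ← neg_smul, uPow]
  congr 1
  ring

theorem contDiff_uPow_add_one {β : ℝ} (hβ : 0 < β) : ContDiff ℝ 1 (uPow n a (β + 1)) := by
  refine contDiff_one_iff_hasFDerivAt.2 ⟨_, ?_, hasFDerivAt_uPow_add_one a hβ⟩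
  have := continuous_uPow a hβ
  fun_prop

theorem fderiv_uPow_add_one_single {β : ℝ} (hβ : 0 < β) (x : EuclideanSpace ℝ (Fin n))
    (i : Fin n) :
    fderiv ℝ (uPow n a (β + 1)) x (EuclideanSpace.single i 1) =
      -(2 * (β + 1) * a i) * (x i * uPow n a β x) := by
  rw [(hasFDerivAt_uPow_add_one a hβ x).fderiv]
  simp [_root_.sum_apply]
  ring

theorem contDiffAt_uPow {β : ℝ} {x : EuclideanSpace ℝ (Fin n)} (hx : x ∈ Ea n a) :
    ContDiffAt ℝ ⊤ (uPow n a β) x := by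
  have hx' : qa n a x < 1 := hx
  have hpos : 1 - qa n a x ≠ 0 := by linarith
  refine ((contDiff_const.sub (contDiff_qa a)).contDiffAt.rpow_const_of_ne (p := β)
    hpos).congr_of_eventuallyEq ?_
  filter_upwards [(contDiff_qa a).continuous.continuousAt.eventually_lt continuousAt_const hx']
    with y hy
  rw [uPow, max_eq_right (by linarith)]

theorem hasCompactSupport_uPow {β : ℝ} (hβ : β ≠ 0) (ha : ∀ i, 0 < a i) :
    HasCompactSupport (uPow n a β) := by
  obtain ⟨c, hc, hca⟩ : ∃ c > 0, ∀ i, c ≤ a i := by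
    rcases isEmpty_or_nonempty (Fin n) with h | h
    · exact ⟨1, one_pos, fun i => h.elim i⟩
    · obtain ⟨j, hj⟩ := Finite.exists_min a
      exact ⟨a j, ha j, hj⟩
  refine HasCompactSupport.intro (isCompact_closedBall 0 (Real.sqrt c⁻¹)) fun x hx => ?_
  rw [mem_closedBall_zero_iff, not_le] at hx
  rw [Real.sqrt_lt' ((Real.sqrt_nonneg _).trans_lt hx)] at hx
  have h1 : 1 ≤ qa n a x := by
    calc (1 : ℝ) = c * c⁻¹ := (mul_inv_cancel₀ hc.ne').symm
      _ ≤ c * ‖x‖ ^ 2 := by gcongr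
      _ ≤ qa n a x := by
        rw [EuclideanSpace.real_norm_sq_eq, Finset.mul_sum]
        exact Finset.sum_le_sum fun j _ => by gcongr; exact hca j
  rw [uPow, max_eq_left (by linarith), Real.zero_rpow hβ]

end Ellipsoid

theorem finDiff_eq_fwdDiff_iter (n m : ℕ) (u : EuclideanSpace ℝ (Fin n) → ℝ)
    (x y : EuclideanSpace ℝ (Fin n)) :
    finDiff n m u x y = (-1) ^ m * (fwdDiff y)^[2 * m] u (x - (m : ℝ) • y) := by
  rw [fwdDiff_iter_eq_sum_shift, Finset.mul_sum, finDiff]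
  refine Finset.sum_nbij' (fun k => (k + m).toNat) (fun j => (j : ℤ) - m) ?_ ?_ ?_ ?_ ?_
  · intro k hk
    rw [Finset.mem_Icc] at hk
    rw [Finset.mem_range]
    omega
  · intro j hj
    rw [Finset.mem_range] at hj
    rw [Finset.mem_Icc]
    omega
  · intro k hk
    rw [Finset.mem_Icc] at hk
    omega
  · intro j hj
    omega
  · intro k hk
    rw [Finset.mem_Icc] at hk
    obtain ⟨j, hj⟩ := Int.eq_ofNat_of_zero_le (show 0 ≤ k + m by omega)
    obtain rfl : k = (j : ℤ) - m := by omega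
    have hj2 : j ≤ 2 * m := by omega
    have h1 : ((m : ℤ) - ((j : ℤ) - m)).toNat = 2 * m - j := by omega
    have h2 : ((j : ℤ) - m + m).toNat = j := by omega
    have hsign : (-1 : ℝ) ^ ((j : ℤ) - m) = (-1) ^ m * (-1) ^ (2 * m - j) := by
      rw [← pow_add, zpow_sub₀ (by norm_num), zpow_natCast, zpow_natCast,
        div_eq_iff (by positivity), ← pow_add,
        show m + (2 * m - j) + m = j + 2 * (2 * m - j) by omega, pow_add _ j, pow_mul]
      norm_num
    have harg : x - (m : ℝ) • y + j • y = x + (((j : ℤ) - m : ℤ) : ℝ) • y := by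
      rw [← Nat.cast_smul_eq_nsmul ℝ]
      push_cast
      module
    rw [h1, h2, hsign, Nat.choose_symm hj2, harg, zsmul_eq_mul]
    push_cast
    ring

theorem Lms_eq_integral_fwdDiff_iter (n m : ℕ) (s : ℝ) (u : EuclideanSpace ℝ (Fin n) → ℝ)
    (x : EuclideanSpace ℝ (Fin n)) :
    Lms n m s u x = cnms n m s / 2 * (-1) ^ m * ∫ y : EuclideanSpace ℝ (Fin n),
      (‖y‖ ^ ((n : ℝ) + 2 * s))⁻¹ • (fwdDiff y)^[2 * m] u (x - (m : ℝ) • y) := by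
  rw [Lms, mul_assoc]
  congr 1
  rw [← integral_const_mul]
  congr 1
  ext y
  rw [finDiff_eq_fwdDiff_iter, smul_eq_mul]
  ring

/-- recurrence for `(-Δ)^s (xᵢ u_β)`. -/
theorem statement6 (n m : ℕ) (s β : ℝ) (hn : 2 ≤ n) (hs : 0 < s) (hβ : 0 < β) (hm : s < m)
    (a : Fin n → ℝ) (ha : ∀ i, 0 < a i) (i : Fin n) :
    ∀ x ∈ Ea n a,
      Lms n m s (fun y => y i * uPow n a β y) x =
        -(1 / (2 * (β + 1) * a i)) *
          fderiv ℝ (Lms n m s (uPow n a (β + 1))) x (EuclideanSpace.single i 1) := by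
  intro x hx
  have hfr : Module.finrank ℝ (EuclideanSpace ℝ (Fin n)) = n := finrank_euclideanSpace_fin
  obtain ⟨hint, hderiv⟩ := hasFDerivAt_integral_fwdDiff_iter
    (volume : Measure (EuclideanSpace ℝ (Fin n))) (v := uPow n a (β + 1)) (x := x) (c := m)
    (N := 2 * m) (p := (n : ℝ) + 2 * s) (by omega) (contDiff_uPow_add_one a hβ)
    (hasCompactSupport_uPow a (by positivity) ha)
    ((contDiffAt_uPow a hx).of_le le_top) (by rw [hfr]; linarith)
    (by rw [hfr]; push_cast; linarith)
  have hLms : Lms n m s (uPow n a (β + 1)) = fun x => cnms n m s / 2 * (-1) ^ m *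
      ∫ y : EuclideanSpace ℝ (Fin n), (‖y‖ ^ ((n : ℝ) + 2 * s))⁻¹ •
        (fwdDiff y)^[2 * m] (uPow n a (β + 1)) (x - (m : ℝ) • y) :=
    funext fun x => Lms_eq_integral_fwdDiff_iter n m s _ x
  have hpoint : ∀ y z : EuclideanSpace ℝ (Fin n),
      (fwdDiff y)^[2 * m] (fderiv ℝ (uPow n a (β + 1))) z (EuclideanSpace.single i 1) =
        -(2 * (β + 1) * a i) * (fwdDiff y)^[2 * m] (fun y => y i * uPow n a β y) z := by
    intro y z
    simp only [fwdDiff_iter_eq_sum_shift, _root_.sum_apply, Finset.mul_sum]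
    refine Finset.sum_congr rfl fun k _ => ?_
    rw [← Int.cast_smul_eq_zsmul ℝ, _root_.smul_apply,
      fderiv_uPow_add_one_single a hβ, zsmul_eq_mul, smul_eq_mul]
    ring
  rw [hLms, (hderiv.const_mul _).fderiv, _root_.smul_apply,
    ContinuousLinearMap.integral_apply hint, Lms_eq_integral_fwdDiff_iter]
  simp only [_root_.smul_apply, hpoint]
  have hconst : ∀ r t u : ℝ, r • (t * u) = t * (r • u) := fun r t u => mul_left_comm r t u
  simp only [hconst, integral_const_mul]
  rw [smul_eq_mul]
  have := (ha i).ne'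
  have : β + 1 ≠ 0 := by positivity
  field_simp
end
end

section
/- Let n ≥ 2, s > 0, and i ∈ ℕ₀. Then lim_{a→∞} J_i^{(n)}/J_0 = 1. Moreover, if s > i − 1/2, then lim_{a→∞} (a^i J_i^{(1)})/J_0 = Γ(i+1/2) Γ(s−i+1/2)/(Γ(1/2) Γ(s+1/2)) = Π_{k=0}^{i−1} (1+2k)/(2s−2k−1). -/
open MeasureTheory Finset Filter
open scoped BigOperators NNReal ENNReal FourierTransform

noncomputable section

theorem hausdorffMeasure_image_le_of_dist_le {X Y Z : Type*} [Nonempty X]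
    [MetricSpace Y] [MeasurableSpace Y] [BorelSpace Y]
    [MetricSpace Z] [MeasurableSpace Z] [BorelSpace Z]
    {f : X → Y} {g : X → Z} {S : Set X} {K : ℝ≥0} {d : ℝ} (hd : 0 ≤ d)
    (h : ∀ x ∈ S, ∀ y ∈ S, dist (f x) (f y) ≤ K * dist (g x) (g y)) :
    μH[d] (f '' S) ≤ (K : ℝ≥0∞) ^ d * μH[d] (g '' S) := by
  have hinv : ∀ x ∈ S, Function.invFunOn g S (g x) ∈ S ∧ g (Function.invFunOn g S (g x)) = g x :=
    fun x hx => Function.invFunOn_pos ⟨x, hx, rfl⟩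
  have hfg : ∀ x ∈ S, f (Function.invFunOn g S (g x)) = f x := by
    intro x hx
    have := h _ (hinv x hx).1 x hx
    rw [(hinv x hx).2, dist_self, mul_zero] at this
    exact dist_le_zero.1 this
  have himg : (f ∘ Function.invFunOn g S) '' (g '' S) = f '' S := by
    rw [Set.image_image]
    exact Set.image_congr hfg
  have hlip : LipschitzOnWith K (f ∘ Function.invFunOn g S) (g '' S) := by
    refine LipschitzOnWith.of_dist_le_mul ?_
    rintro _ ⟨x, hx, rfl⟩ _ ⟨y, hy, rfl⟩
    simp only [Function.comp_apply, hfg x hx, hfg y hy]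
    exact h x hx y hy
  rw [← himg]
  exact hlip.hausdorffMeasure_image_le hd

section AreaFormula

variable {F E : Type*} [NormedAddCommGroup F] [NormedSpace ℝ F] [FiniteDimensional ℝ F]
  [MeasurableSpace F] [BorelSpace F]
  [NormedAddCommGroup E] [NormedSpace ℝ E] [MeasurableSpace E] [BorelSpace E]

/-- Near a point of strict differentiability, the Hausdorff measure of the image is comparable,
up to factors close to one, to the Haar measure times the Jacobian; the Jacobian is read off from
an endomorphism with the same metric distortion as the derivative. -/
theorem exists_nhds_hausdorffMeasure_image_comparable {Φ : F → E} {L : F →L[ℝ] E} {T : F →ₗ[ℝ] F}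
    {y : F} (hΦ : HasStrictFDerivAt Φ L y) (hT : ∀ v, ‖T v‖ = ‖L v‖) (hdet : LinearMap.det T ≠ 0)
    {K : ℝ≥0} (hK : 1 < K) :
    ∃ u ∈ nhds y, ∀ S ⊆ u,
      μH[(Module.finrank ℝ F : ℝ)] (Φ '' S) ≤ (K : ℝ≥0∞) ^ (Module.finrank ℝ F : ℝ) *
        (ENNReal.ofReal |LinearMap.det T| * μH[(Module.finrank ℝ F : ℝ)] S) ∧
      ENNReal.ofReal |LinearMap.det T| * μH[(Module.finrank ℝ F : ℝ)] S ≤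
        (K : ℝ≥0∞) ^ (Module.finrank ℝ F : ℝ) * μH[(Module.finrank ℝ F : ℝ)] (Φ '' S) := by
  obtain ⟨C, hC, hanti⟩ := T.exists_antilipschitzWith
    (LinearMap.ker_eq_bot.2 (LinearMap.equivOfDetNeZero T hdet).injective)
  have hK' : (1 : ℝ) < K := by exact_mod_cast hK
  have hC' : (0 : ℝ) < C := by exact_mod_cast hC
  have hc0 : 0 < (1 - 1 / (K : ℝ)) / C := by
    refine div_pos ?_ hC'
    rw [sub_pos, div_lt_one (by linarith)]
    exact hK'
  obtain ⟨u, hu, happ⟩ := hΦ.approximates_deriv_on_nhds (c := ⟨_, hc0.le⟩) (Or.inr hc0)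
  have hbound : ∀ x ∈ u, ∀ z ∈ u,
      ‖Φ x - Φ z - L (x - z)‖ ≤ (1 - 1 / (K : ℝ)) * ‖T (x - z)‖ := by
    intro x hx z hz
    have h1 : ‖Φ x - Φ z - L (x - z)‖ ≤ (1 - 1 / (K : ℝ)) / C * ‖x - z‖ := happ x hx z hz
    have h2 : ‖x - z‖ ≤ C * ‖T (x - z)‖ := by
      simpa [dist_eq_norm] using hanti.le_mul_dist x z
    refine h1.trans ((mul_le_mul_of_nonneg_left h2 hc0.le).trans_eq ?_)
    field_simp
  have hKinv : 1 / (K : ℝ) * K = 1 := by field_simp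
  have hKinv' : 1 - 1 / (K : ℝ) ≤ K - 1 := by
    nlinarith [sq_nonneg ((K : ℝ) - 1), one_div_pos.2 (by linarith : (0 : ℝ) < K)]
  refine ⟨u, hu, fun S hS => ?_⟩
  rw [← Measure.addHaar_image_linearMap]
  have hd : (0 : ℝ) ≤ Module.finrank ℝ F := Nat.cast_nonneg _
  constructor
  · refine hausdorffMeasure_image_le_of_dist_le hd fun x hx z hz => ?_
    have h := hbound x (hS hx) z (hS hz)
    rw [dist_eq_norm, dist_eq_norm, ← map_sub]
    have h3 : ‖Φ x - Φ z‖ ≤ ‖Φ x - Φ z - L (x - z)‖ + ‖L (x - z)‖ := by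
      simpa using norm_add_le (Φ x - Φ z - L (x - z)) (L (x - z))
    rw [← hT] at h3
    nlinarith [norm_nonneg (T (x - z))]
  · refine hausdorffMeasure_image_le_of_dist_le hd fun x hx z hz => ?_
    have h := hbound x (hS hx) z (hS hz)
    rw [dist_eq_norm, dist_eq_norm, ← map_sub]
    have h3 : ‖L (x - z)‖ ≤ ‖Φ x - Φ z‖ + ‖Φ x - Φ z - L (x - z)‖ := by
      have := norm_sub_le (Φ x - Φ z) (Φ x - Φ z - L (x - z))
      simpa using this
    rw [← hT] at h3
    have h4 : 1 / (K : ℝ) * ‖T (x - z)‖ ≤ ‖Φ x - Φ z‖ := by linarith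
    calc ‖T (x - z)‖ = K * (1 / (K : ℝ) * ‖T (x - z)‖) := by field_simp
      _ ≤ K * ‖Φ x - Φ z‖ := by gcongr

theorem le_of_forall_one_lt_le_rpow_mul {A B : ℝ≥0∞} {d : ℝ}
    (h : ∀ K : ℝ≥0, 1 < K → A ≤ (K : ℝ≥0∞) ^ d * B) (hB : B ≠ ⊤) : A ≤ B := by
  have h1 : Tendsto (fun K : ℝ≥0 => (K : ℝ≥0∞) ^ d * B) (nhdsWithin 1 (Set.Ioi 1)) (nhds B) := by
    have h2 : Tendsto (fun K : ℝ≥0 => (K : ℝ≥0∞) ^ d) (nhds 1) (nhds 1) := by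
      have h3 : Tendsto (fun K : ℝ≥0 => (K : ℝ≥0∞)) (nhds 1) (nhds 1) :=
        ENNReal.tendsto_coe.2 tendsto_id
      simpa [Function.comp_def] using (ENNReal.continuous_rpow_const (y := d)).continuousAt.tendsto.comp h3
    simpa using ENNReal.Tendsto.mul_const (h2.mono_left nhdsWithin_le_nhds) (Or.inr hB)
  exact ge_of_tendsto h1 (eventually_mem_nhdsWithin.mono h)

/-- Area formula for an injective strictly differentiable map out of a finite-dimensional space. -/
theorem comap_hausdorffMeasure_eq_withDensity [HasBesicovitchCovering F] {Φ : F → E}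
    {L : F → F →L[ℝ] E} {T : F → F →ₗ[ℝ] F} (hinj : Function.Injective Φ)
    (hΦ : ∀ y, HasStrictFDerivAt Φ (L y) y) (hT : ∀ y v, ‖T y v‖ = ‖L y v‖)
    (hdet : ∀ y, LinearMap.det (T y) ≠ 0) :
    (μH[(Module.finrank ℝ F : ℝ)] : Measure E).comap Φ =
      (μH[(Module.finrank ℝ F : ℝ)] : Measure F).withDensity
        fun y => ENNReal.ofReal |LinearMap.det (T y)| := by
  have : ProperSpace F := FiniteDimensional.proper_real F
  have hcont : Continuous Φ := continuous_iff_continuousAt.2 fun y => (hΦ y).continuousAt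
  have hemb : MeasurableEmbedding Φ := hcont.measurableEmbedding hinj
  set d : ℝ := (Module.finrank ℝ F : ℝ)
  set lam : Measure F := μH[d] with hlam
  set ν : Measure F := (μH[d] : Measure E).comap Φ with hν
  have : lam.IsAddHaarMeasure := isAddHaarMeasure_hausdorffMeasure
  have hloc : ∀ y, ∀ K : ℝ≥0, 1 < K → ∃ u ∈ nhds y, ∀ S ⊆ u,
      ν S ≤ (K : ℝ≥0∞) ^ d * (ENNReal.ofReal |LinearMap.det (T y)| * lam S) ∧
      ENNReal.ofReal |LinearMap.det (T y)| * lam S ≤ (K : ℝ≥0∞) ^ d * ν S := by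
    intro y K hK
    obtain ⟨u, hu, h⟩ := exists_nhds_hausdorffMeasure_image_comparable (hΦ y) (hT y) (hdet y) hK
    refine ⟨u, hu, fun S hS => ?_⟩
    rw [hν, hemb.comap_apply]
    exact h S hS
  have hKtop : ∀ K : ℝ≥0, (K : ℝ≥0∞) ^ d ≠ ⊤ := fun K =>
    ENNReal.rpow_ne_top_of_nonneg (Nat.cast_nonneg _) ENNReal.coe_ne_top
  have : IsLocallyFiniteMeasure ν := by
    refine ⟨fun y => ?_⟩
    obtain ⟨u, hu, h⟩ := hloc y 2 (by norm_num)
    obtain ⟨w, hw, hwfin⟩ := lam.finiteAt_nhds y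
    refine ⟨u ∩ w, inter_mem hu hw, ((h _ Set.inter_subset_left).1).trans_lt ?_⟩
    exact ENNReal.mul_lt_top (hKtop 2).lt_top (ENNReal.mul_lt_top ENNReal.ofReal_lt_top
      ((measure_mono Set.inter_subset_right).trans_lt hwfin))
  have hac : ν ≪ lam := by
    intro S hS
    refine measure_null_of_locally_null S fun y _ => ?_
    obtain ⟨u, hu, h⟩ := hloc y 2 (by norm_num)
    refine ⟨S ∩ u, inter_mem self_mem_nhdsWithin (mem_nhdsWithin_of_mem_nhds hu), ?_⟩
    have h1 := (h (S ∩ u) Set.inter_subset_right).1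
    rw [measure_mono_null Set.inter_subset_left hS] at h1
    simpa using h1
  rw [← Measure.withDensity_rnDeriv_eq ν lam hac]
  refine withDensity_congr_ae ?_
  filter_upwards [Besicovitch.ae_tendsto_rnDeriv ν lam] with y hy
  have hball : ∀ K : ℝ≥0, 1 < K → ∀ᶠ r in nhdsWithin (0 : ℝ) (Set.Ioi 0),
      ν (Metric.closedBall y r) / lam (Metric.closedBall y r) ≤
        (K : ℝ≥0∞) ^ d * ENNReal.ofReal |LinearMap.det (T y)| ∧
      ENNReal.ofReal |LinearMap.det (T y)| ≤
        (K : ℝ≥0∞) ^ d * (ν (Metric.closedBall y r) / lam (Metric.closedBall y r)) := by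
    intro K hK
    obtain ⟨u, hu, h⟩ := hloc y K hK
    obtain ⟨ε, hε, hεu⟩ := Metric.nhds_basis_closedBall.mem_iff.1 hu
    filter_upwards [Ioc_mem_nhdsGT hε] with r hr
    obtain ⟨h1, h2⟩ := h _ ((Metric.closedBall_subset_closedBall hr.2).trans hεu)
    have hpos : lam (Metric.closedBall y r) ≠ 0 :=
      (Metric.measure_closedBall_pos lam y hr.1).ne'
    have hfin : lam (Metric.closedBall y r) ≠ ⊤ := measure_closedBall_lt_top.ne
    constructor
    · rw [ENNReal.div_le_iff hpos hfin, mul_assoc]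
      exact h1
    · rw [← mul_div_assoc, ENNReal.le_div_iff_mul_le (Or.inl hpos) (Or.inl hfin)]
      exact h2
  have hle : ∀ K : ℝ≥0, 1 < K →
      ν.rnDeriv lam y ≤ (K : ℝ≥0∞) ^ d * ENNReal.ofReal |LinearMap.det (T y)| :=
    fun K hK => le_of_tendsto hy ((hball K hK).mono fun _ h => h.1)
  have hge : ∀ K : ℝ≥0, 1 < K →
      ENNReal.ofReal |LinearMap.det (T y)| ≤ (K : ℝ≥0∞) ^ d * ν.rnDeriv lam y :=
    fun K hK => ge_of_tendsto (ENNReal.Tendsto.const_mul hy (Or.inr (hKtop K)))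
      ((hball K hK).mono fun _ h => h.2)
  have hle' := le_of_forall_one_lt_le_rpow_mul hle ENNReal.ofReal_ne_top
  exact le_antisymm hle' (le_of_forall_one_lt_le_rpow_mul hge
    (ne_top_of_le_ne_top ENNReal.ofReal_ne_top hle'))

end AreaFormula

/-- The inclusion of `ℝ^m` into `ℝ^(m+1)` as the hyperplane of vanishing last coordinate. -/
def hyperplaneInclusion (m : ℕ) :
    EuclideanSpace ℝ (Fin m) →ₗᵢ[ℝ] EuclideanSpace ℝ (Fin (m + 1)) where
  toFun v := WithLp.toLp 2 (Fin.snoc (α := fun _ => ℝ) v 0)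
  map_add' v w := by
    ext j
    refine Fin.lastCases ?_ (fun j => ?_) j <;> simp
  map_smul' c v := by
    ext j
    refine Fin.lastCases ?_ (fun j => ?_) j <;> simp
  norm_map' v := by
    simp [EuclideanSpace.norm_eq, Fin.sum_univ_castSucc]

@[simp]
theorem hyperplaneInclusion_castSucc {m : ℕ} (v : EuclideanSpace ℝ (Fin m)) (j : Fin m) :
    hyperplaneInclusion m v j.castSucc = v j := by
  simp [hyperplaneInclusion]

@[simp]
theorem hyperplaneInclusion_last {m : ℕ} (v : EuclideanSpace ℝ (Fin m)) :
    hyperplaneInclusion m v (Fin.last m) = 0 := by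
  simp [hyperplaneInclusion]

/-- The last vector of the standard basis of `ℝ^(m+1)`. -/
def lastBasisVec (m : ℕ) : EuclideanSpace ℝ (Fin (m + 1)) := EuclideanSpace.single (Fin.last m) 1

@[simp]
theorem lastBasisVec_castSucc {m : ℕ} (j : Fin m) : lastBasisVec m j.castSucc = 0 := by
  simp [lastBasisVec, (Fin.castSucc_lt_last j).ne]

@[simp]
theorem lastBasisVec_last {m : ℕ} : lastBasisVec m (Fin.last m) = 1 := by
  simp [lastBasisVec]

theorem norm_sq_hyperplaneInclusion_add {m : ℕ} (v : EuclideanSpace ℝ (Fin m)) (h : ℝ) :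
    ‖hyperplaneInclusion m v + h • lastBasisVec m‖ ^ 2 = ‖v‖ ^ 2 + h ^ 2 := by
  simp [EuclideanSpace.norm_sq_eq, Fin.sum_univ_castSucc]

theorem qa_avec {m : ℕ} (a : ℝ) (θ : EuclideanSpace ℝ (Fin (m + 1))) :
    qa (m + 1) (avec (m + 1) a) θ =
      ∑ j : Fin m, θ j.castSucc ^ 2 + a * θ (Fin.last m) ^ 2 := by
  have (j : Fin m) : (j : ℕ) ≠ m := j.isLt.ne
  simp [qa, avec, Fin.sum_univ_castSucc, this]

theorem norm_sq_Avec_avec {m : ℕ} (a : ℝ) (θ : EuclideanSpace ℝ (Fin (m + 1))) :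
    ‖Avec (m + 1) (avec (m + 1) a) θ‖ ^ 2 =
      ∑ j : Fin m, θ j.castSucc ^ 2 + a ^ 2 * θ (Fin.last m) ^ 2 := by
  have (j : Fin m) : (j : ℕ) ≠ m := j.isLt.ne
  simp [Avec, avec, EuclideanSpace.norm_sq_eq, Fin.sum_univ_castSucc, this, mul_pow]

/-- The factor that scales the point `(y, 1)` onto the ellipsoid `|x'|² + a x_n² = 1`. -/
def gnomonicScale {m : ℕ} (a : ℝ) (y : EuclideanSpace ℝ (Fin m)) : ℝ :=
  (‖y‖ ^ 2 + a) ^ (-1 / 2 : ℝ)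

theorem gnomonicScale_pos {m : ℕ} {a : ℝ} (ha : 0 < a) (y : EuclideanSpace ℝ (Fin m)) :
    0 < gnomonicScale a y :=
  Real.rpow_pos_of_pos (by positivity) _

theorem gnomonicScale_sq {m : ℕ} {a : ℝ} (ha : 0 < a) (y : EuclideanSpace ℝ (Fin m)) :
    gnomonicScale a y ^ 2 * (‖y‖ ^ 2 + a) = 1 := by
  have h : 0 < ‖y‖ ^ 2 + a := by positivity
  rw [gnomonicScale, ← Real.rpow_natCast, ← Real.rpow_mul h.le]
  norm_num [Real.rpow_neg_one, h.ne']

/-- Gnomonic parametrization of the sheet of the ellipsoid `|x'|² + a x_n² = 1` on which the sign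
of `x_n` is `σ`. -/
def gnomonic {m : ℕ} (σ a : ℝ) (y : EuclideanSpace ℝ (Fin m)) : EuclideanSpace ℝ (Fin (m + 1)) :=
  (σ * gnomonicScale a y) • (hyperplaneInclusion m y + lastBasisVec m)

@[simp]
theorem gnomonic_castSucc {m : ℕ} (σ a : ℝ) (y : EuclideanSpace ℝ (Fin m)) (j : Fin m) :
    gnomonic σ a y j.castSucc = σ * gnomonicScale a y * y j := by
  simp [gnomonic]

@[simp]
theorem gnomonic_last {m : ℕ} (σ a : ℝ) (y : EuclideanSpace ℝ (Fin m)) :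
    gnomonic σ a y (Fin.last m) = σ * gnomonicScale a y := by
  simp [gnomonic]

/-- The derivative of the gnomonic parametrization. -/
def gnomonicDeriv {m : ℕ} (σ a : ℝ) (y : EuclideanSpace ℝ (Fin m)) :
    EuclideanSpace ℝ (Fin m) →L[ℝ] EuclideanSpace ℝ (Fin (m + 1)) :=
  (σ * gnomonicScale a y) • (hyperplaneInclusion m).toContinuousLinearMap +
    ((-σ * gnomonicScale a y ^ 3) • innerSL ℝ y).smulRight
      (hyperplaneInclusion m y + lastBasisVec m)

theorem hasStrictFDerivAt_gnomonicScale {m : ℕ} {a : ℝ} (ha : 0 < a)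
    (y : EuclideanSpace ℝ (Fin m)) :
    HasStrictFDerivAt (gnomonicScale a) ((-gnomonicScale a y ^ 3) • innerSL ℝ y) y := by
  have h : 0 < ‖y‖ ^ 2 + a := by positivity
  have h1 := ((hasStrictFDerivAt_norm_sq y).add_const a).rpow_const (p := -1 / 2) (Or.inl h.ne')
  refine h1.congr_fderiv ?_
  have h2 : gnomonicScale a y ^ 3 = (‖y‖ ^ 2 + a) ^ (-1 / 2 - 1 : ℝ) := by
    rw [gnomonicScale, ← Real.rpow_natCast, ← Real.rpow_mul h.le]
    norm_num
  rw [h2]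
  ext v
  simp
  ring

theorem hasStrictFDerivAt_gnomonic {m : ℕ} {a : ℝ} (ha : 0 < a) (σ : ℝ)
    (y : EuclideanSpace ℝ (Fin m)) :
    HasStrictFDerivAt (gnomonic σ a) (gnomonicDeriv σ a y) y := by
  have h1 := (hasStrictFDerivAt_gnomonicScale ha y).const_mul σ
  have h2 := ((hyperplaneInclusion m).toContinuousLinearMap.hasStrictFDerivAt (x := y)).add_const
    (lastBasisVec m)
  refine (h1.smul h2).congr_fderiv ?_
  rw [gnomonicDeriv, smul_smul, mul_neg, neg_mul]
  simp

theorem gnomonicDeriv_apply {m : ℕ} (σ a : ℝ) (y v : EuclideanSpace ℝ (Fin m)) :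
    gnomonicDeriv σ a y v = σ • (hyperplaneInclusion m
      (gnomonicScale a y • (v - (gnomonicScale a y ^ 2 * inner ℝ y v) • y)) +
        (-gnomonicScale a y ^ 3 * inner ℝ y v) • lastBasisVec m) := by
  simp only [gnomonicDeriv, add_apply, smul_apply,
    ContinuousLinearMap.smulRight_apply, innerSL_apply_apply, map_smul, map_sub, smul_eq_mul,
    LinearIsometry.coe_toContinuousLinearMap]
  module

/-- `sqrt (a² + |y|²) / (a + |y|²)`. -/
def gnomonicStretch {m : ℕ} (a : ℝ) (y : EuclideanSpace ℝ (Fin m)) : ℝ :=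
  gnomonicScale a y ^ 2 * Real.sqrt (a ^ 2 + ‖y‖ ^ 2)

/-- A linear endomorphism of `ℝ^m` with the same metric distortion as `gnomonicDeriv`. -/
def gnomonicMetric {m : ℕ} (a : ℝ) (y : EuclideanSpace ℝ (Fin m)) :
    EuclideanSpace ℝ (Fin m) →ₗ[ℝ] EuclideanSpace ℝ (Fin m) :=
  gnomonicScale a y • LinearMap.transvection (innerₛₗ ℝ y)
    (((-2 * gnomonicScale a y ^ 2 + gnomonicScale a y ^ 4 * (‖y‖ ^ 2 + 1)) /
      (1 + gnomonicStretch a y)) • y)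

theorem gnomonicStretch_nonneg {m : ℕ} (a : ℝ) (y : EuclideanSpace ℝ (Fin m)) :
    0 ≤ gnomonicStretch a y := by
  unfold gnomonicStretch
  positivity

theorem gnomonicStretch_sq {m : ℕ} {a : ℝ} (ha : 0 < a) (y : EuclideanSpace ℝ (Fin m)) :
    gnomonicStretch a y ^ 2 = 1 +
      (-2 * gnomonicScale a y ^ 2 + gnomonicScale a y ^ 4 * (‖y‖ ^ 2 + 1)) * ‖y‖ ^ 2 := by
  rw [gnomonicStretch, mul_pow, Real.sq_sqrt (by positivity)]
  have h := gnomonicScale_sq ha y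
  linear_combination (gnomonicScale a y ^ 2 * (a - ‖y‖ ^ 2) + 1) * h

theorem norm_gnomonicMetric {m : ℕ} {a σ : ℝ} (ha : 0 < a) (hσ : |σ| = 1)
    (y v : EuclideanSpace ℝ (Fin m)) :
    ‖gnomonicMetric a y v‖ = ‖gnomonicDeriv σ a y v‖ := by
  have hw := gnomonicStretch_nonneg a y
  have hw2 := gnomonicStretch_sq ha y
  rw [← sq_eq_sq₀ (norm_nonneg _) (norm_nonneg _), gnomonicDeriv_apply, norm_smul,
    Real.norm_eq_abs, hσ, one_mul, norm_sq_hyperplaneInclusion_add, gnomonicMetric,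
    LinearMap.smul_apply, LinearMap.transvection.apply, norm_smul, norm_smul, mul_pow, mul_pow,
    norm_add_sq_real, norm_sub_sq_real]
  set t := gnomonicScale a y
  set β := -2 * t ^ 2 + t ^ 4 * (‖y‖ ^ 2 + 1) with hβ
  set w := gnomonicStretch a y
  obtain ⟨κ, hκ⟩ : ∃ κ, κ = β / (1 + w) := ⟨_, rfl⟩
  have hκ1 : κ * (1 + w) = β := by
    rw [hκ]
    field_simp
  have hκ2 : κ * ‖y‖ ^ 2 = w - 1 := by
    rw [hκ]
    field_simp
    linarith
  rw [← hκ]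
  simp only [innerₛₗ_apply_apply, real_inner_smul_right, norm_smul, Real.norm_eq_abs, mul_pow,
    sq_abs, real_inner_comm]
  rw [real_inner_comm v y]
  set q := inner ℝ v y
  linear_combination t ^ 2 * q ^ 2 * (hκ1 + κ * hκ2 + hβ)

theorem det_gnomonicMetric {m : ℕ} {a : ℝ} (ha : 0 < a) (y : EuclideanSpace ℝ (Fin m)) :
    LinearMap.det (gnomonicMetric a y) = gnomonicScale a y ^ m * gnomonicStretch a y := by
  have hw := gnomonicStretch_nonneg a y
  have hw2 := gnomonicStretch_sq ha y
  rw [gnomonicMetric, LinearMap.det_smul, LinearMap.transvection.det, finrank_euclideanSpace_fin,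
    innerₛₗ_apply_apply, real_inner_smul_right, real_inner_self_eq_norm_sq]
  congr 1
  field_simp
  linarith

theorem gnomonicStretch_pos {m : ℕ} {a : ℝ} (ha : 0 < a) (y : EuclideanSpace ℝ (Fin m)) :
    0 < gnomonicStretch a y :=
  mul_pos (pow_pos (gnomonicScale_pos ha y) 2) (Real.sqrt_pos.2 (by positivity))

theorem gnomonic_injective {m : ℕ} {a σ : ℝ} (ha : 0 < a) (hσ : |σ| = 1) :
    Function.Injective (gnomonic (m := m) σ a) := by
  intro y z h
  have hσ0 : σ ≠ 0 := by
    rintro rfl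
    simp at hσ
  have hlast : gnomonicScale a y = gnomonicScale a z := by
    have := congrArg (fun θ => θ (Fin.last m)) h
    simpa [hσ0] using this
  ext j
  have hj := congrArg (fun θ => θ j.castSucc) h
  simpa [hσ0, hlast, (gnomonicScale_pos ha z).ne'] using hj

theorem comap_gnomonic {m : ℕ} {a σ : ℝ} (ha : 0 < a) (hσ : |σ| = 1) :
    (μH[(m : ℝ)] : Measure (EuclideanSpace ℝ (Fin (m + 1)))).comap (gnomonic σ a) =
      (μH[(m : ℝ)] : Measure (EuclideanSpace ℝ (Fin m))).withDensity
        fun y => ENNReal.ofReal (gnomonicScale a y ^ m * gnomonicStretch a y) := by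
  have hpos (y : EuclideanSpace ℝ (Fin m)) : 0 < gnomonicScale a y ^ m * gnomonicStretch a y :=
    mul_pos (pow_pos (gnomonicScale_pos ha y) m) (gnomonicStretch_pos ha y)
  have h := comap_hausdorffMeasure_eq_withDensity (gnomonic_injective (m := m) ha hσ)
    (hasStrictFDerivAt_gnomonic ha σ) (norm_gnomonicMetric ha hσ)
    (fun y => by rw [det_gnomonicMetric ha]; exact (hpos y).ne')
  simpa only [finrank_euclideanSpace_fin, det_gnomonicMetric ha, abs_of_pos (hpos _)] using h

theorem measurableEmbedding_gnomonic {m : ℕ} {a σ : ℝ} (ha : 0 < a) (hσ : |σ| = 1) :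
    MeasurableEmbedding (gnomonic (m := m) σ a) :=
  (continuous_iff_continuousAt.2 fun y =>
    (hasStrictFDerivAt_gnomonic ha σ y).continuousAt).measurableEmbedding (gnomonic_injective ha hσ)

/-- The ellipsoid is the union of its two open sheets and its equator. -/
theorem ellipsoid_eq_union {m : ℕ} {a : ℝ} (ha : 0 < a) :
    {θ | qa (m + 1) (avec (m + 1) a) θ = 1} =
      (Set.range (gnomonic 1 a) ∪ Set.range (gnomonic (-1) a)) ∪
        hyperplaneInclusion m '' Metric.sphere 0 1 := by
  have hsheet (σ : ℝ) (hσ : |σ| = 1) (y : EuclideanSpace ℝ (Fin m)) :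
      qa (m + 1) (avec (m + 1) a) (gnomonic σ a y) = 1 := by
    have hσ2 : σ ^ 2 = 1 := by rw [← sq_abs, hσ, one_pow]
    have h := gnomonicScale_sq ha y
    rw [EuclideanSpace.real_norm_sq_eq] at h
    simp only [qa_avec, gnomonic_castSucc, gnomonic_last, mul_pow, hσ2, one_mul, ← Finset.mul_sum]
    linarith
  ext θ
  constructor
  · intro hθ
    simp only [Set.mem_ofPred_eq, qa_avec] at hθ
    by_cases hlast : θ (Fin.last m) = 0
    · refine Or.inr ⟨WithLp.toLp 2 fun j => θ j.castSucc, ?_, ?_⟩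
      · rw [mem_sphere_zero_iff_norm, EuclideanSpace.norm_eq]
        simpa [hlast] using hθ
      · ext j
        refine Fin.lastCases ?_ (fun j => ?_) j <;> simp [hlast]
    · set h := θ (Fin.last m)
      set y : EuclideanSpace ℝ (Fin m) := WithLp.toLp 2 fun j => θ j.castSucc / h with hy
      have hscale : gnomonicScale a y = |h| := by
        rw [← sq_eq_sq₀ (gnomonicScale_pos ha y).le (abs_nonneg h), sq_abs]
        have h1 := gnomonicScale_sq ha y
        have h2 : h ^ 2 * (‖y‖ ^ 2 + a) = 1 := by
          rw [hy, EuclideanSpace.real_norm_sq_eq]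
          simp only [div_pow, ← Finset.sum_div]
          field_simp
          linarith
        have h3 : ‖y‖ ^ 2 + a ≠ 0 := by positivity
        exact mul_right_cancel₀ h3 (h1.trans h2.symm)
      have hmem (σ : ℝ) (hσ : σ * |h| = h) : gnomonic σ a y = θ := by
        ext j
        refine Fin.lastCases ?_ (fun j => ?_) j
        · rw [gnomonic_last, hscale, hσ]
        · rw [gnomonic_castSucc, hscale, hσ, hy]
          simp only
          field_simp
      rcases lt_or_gt_of_ne hlast with hneg | hpos
      · exact Or.inl (Or.inr ⟨y, hmem (-1) (by rw [abs_of_neg hneg]; ring)⟩)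
      · exact Or.inl (Or.inl ⟨y, hmem 1 (by rw [abs_of_pos hpos]; ring)⟩)
  · rintro ((⟨y, rfl⟩ | ⟨y, rfl⟩) | ⟨v, hv, rfl⟩)
    · exact hsheet 1 (by simp) y
    · exact hsheet (-1) (by simp) y
    · rw [mem_sphere_zero_iff_norm] at hv
      have h := EuclideanSpace.real_norm_sq_eq v
      simp [qa_avec, ← h, hv]

theorem disjoint_range_gnomonic {m : ℕ} {a : ℝ} (ha : 0 < a) :
    Disjoint (Set.range (gnomonic (m := m) 1 a)) (Set.range (gnomonic (m := m) (-1) a)) := by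
  rw [Set.disjoint_iff_forall_ne]
  rintro _ ⟨y, rfl⟩ _ ⟨z, rfl⟩ h
  have hlast := congrArg (fun θ => θ (Fin.last m)) h
  simp only [gnomonic_last] at hlast
  linarith [gnomonicScale_pos ha y, gnomonicScale_pos ha z]

theorem restrict_ellipsoid {m : ℕ} (hm : 1 ≤ m) {a : ℝ} (ha : 0 < a) :
    (μH[(m : ℝ)] : Measure (EuclideanSpace ℝ (Fin (m + 1)))).restrict
        {θ | qa (m + 1) (avec (m + 1) a) θ = 1} =
      Measure.map (gnomonic 1 a) ((μH[(m : ℝ)] : Measure (EuclideanSpace ℝ (Fin m))).withDensity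
        fun y => ENNReal.ofReal (gnomonicScale a y ^ m * gnomonicStretch a y)) +
      Measure.map (gnomonic (-1) a) ((μH[(m : ℝ)] : Measure (EuclideanSpace ℝ (Fin m))).withDensity
        fun y => ENNReal.ofReal (gnomonicScale a y ^ m * gnomonicStretch a y)) := by
  have h1 : |(1 : ℝ)| = 1 := by simp
  have h2 : |(-1 : ℝ)| = 1 := by simp
  have hequator : (μH[(m : ℝ)] : Measure (EuclideanSpace ℝ (Fin (m + 1))))
      (hyperplaneInclusion m '' Metric.sphere 0 1) = 0 := by
    rw [(hyperplaneInclusion m).isometry.hausdorffMeasure_image (Or.inl (Nat.cast_nonneg m))]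
    have : Nonempty (Fin m) := ⟨⟨0, hm⟩⟩
    have h := Measure.addHaar_sphere
      (μH[(Module.finrank ℝ (EuclideanSpace ℝ (Fin m)) : ℝ)] :
        Measure (EuclideanSpace ℝ (Fin m))) 0 1
    rwa [finrank_euclideanSpace_fin] at h
  rw [ellipsoid_eq_union ha, Measure.restrict_congr_set (union_ae_eq_left_of_ae_eq_empty
      (ae_eq_empty.2 hequator)), Measure.restrict_union (disjoint_range_gnomonic ha)
      (measurableEmbedding_gnomonic ha h2).measurableSet_range,
    ← (measurableEmbedding_gnomonic ha h1).map_comap,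
    ← (measurableEmbedding_gnomonic ha h2).map_comap, comap_gnomonic ha h1, comap_gnomonic ha h2]

theorem norm_gnomonic {m : ℕ} {a σ : ℝ} (ha : 0 < a) (hσ : |σ| = 1)
    (y : EuclideanSpace ℝ (Fin m)) :
    ‖gnomonic σ a y‖ = gnomonicScale a y * (1 + ‖y‖ ^ 2) ^ (1 / 2 : ℝ) := by
  have h := norm_sq_hyperplaneInclusion_add y 1
  rw [one_smul, one_pow, add_comm (‖y‖ ^ 2)] at h
  rw [gnomonic, norm_smul, norm_mul, Real.norm_eq_abs, hσ, one_mul, Real.norm_eq_abs,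
    abs_of_pos (gnomonicScale_pos ha y), ← Real.sqrt_eq_rpow, ← Real.sqrt_sq (norm_nonneg _),
    h]

theorem norm_Avec_gnomonic {m : ℕ} {a σ : ℝ} (ha : 0 < a) (hσ : |σ| = 1)
    (y : EuclideanSpace ℝ (Fin m)) :
    ‖Avec (m + 1) (avec (m + 1) a) (gnomonic σ a y)‖ =
      gnomonicScale a y * Real.sqrt (a ^ 2 + ‖y‖ ^ 2) := by
  have hσ2 : σ ^ 2 = 1 := by rw [← sq_abs, hσ, one_pow]
  have ht := gnomonicScale_pos ha y
  rw [← sq_eq_sq₀ (norm_nonneg _) (by positivity), norm_sq_Avec_avec, mul_pow,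
    Real.sq_sqrt (by positivity), EuclideanSpace.real_norm_sq_eq]
  simp only [gnomonic_castSucc, gnomonic_last, mul_pow, hσ2, one_mul, ← Finset.mul_sum]
  ring

theorem gnomonicScale_rpow {m : ℕ} {a : ℝ} (ha : 0 < a) (y : EuclideanSpace ℝ (Fin m)) (b : ℝ) :
    gnomonicScale a y ^ (2 * b) = (‖y‖ ^ 2 + a) ^ (-b) := by
  rw [gnomonicScale, ← Real.rpow_mul (by positivity)]
  congr 1
  ring

theorem neg_gnomonic {m : ℕ} (σ a : ℝ) (y : EuclideanSpace ℝ (Fin m)) :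
    -gnomonic σ a y = gnomonic (-σ) a y := by
  rw [gnomonic, gnomonic, ← neg_smul, neg_mul]

/-- The density of the measure `μ` in gnomonic coordinates. -/
theorem gnomonic_density {m : ℕ} {a σ : ℝ} (ha : 0 < a) (hσ : |σ| = 1) (s : ℝ)
    (y : EuclideanSpace ℝ (Fin m)) :
    gnomonicScale a y ^ m * gnomonicStretch a y / (‖gnomonic σ a y‖ ^ (((m + 1 : ℕ) : ℝ) + 2 * s) *
        ‖Avec (m + 1) (avec (m + 1) a) (gnomonic σ a y)‖) =
      (‖y‖ ^ 2 + a) ^ s * (1 + ‖y‖ ^ 2) ^ (-(((m : ℝ) + 1) / 2 + s)) := by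
  have ht := gnomonicScale_pos ha y
  have hq : 0 < 1 + ‖y‖ ^ 2 := by positivity
  have hR : 0 < Real.sqrt (a ^ 2 + ‖y‖ ^ 2) := Real.sqrt_pos.2 (by positivity)
  have hA : 0 < ‖y‖ ^ 2 + a := by positivity
  rw [norm_gnomonic ha hσ, norm_Avec_gnomonic ha hσ, Real.mul_rpow ht.le (by positivity),
    Real.rpow_add ht, Real.rpow_natCast, gnomonicScale_rpow ha, ← Real.rpow_mul hq.le,
    gnomonicStretch, Real.rpow_neg hA.le, Real.rpow_neg hq.le]
  have h : 1 / 2 * (((m + 1 : ℕ) : ℝ) + 2 * s) = ((m : ℝ) + 1) / 2 + s := by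
    push_cast
    ring
  rw [h]
  have h1 : 0 < (1 + ‖y‖ ^ 2) ^ (((m : ℝ) + 1) / 2 + s) := Real.rpow_pos_of_pos hq _
  have h2 : 0 < (‖y‖ ^ 2 + a) ^ s := Real.rpow_pos_of_pos hA _
  field_simp
  ring

theorem continuous_gnomonicScale {m : ℕ} {a : ℝ} (ha : 0 < a) :
    Continuous (gnomonicScale (m := m) a) :=
  continuous_iff_continuousAt.2 fun y => (hasStrictFDerivAt_gnomonicScale ha y).continuousAt

theorem surfInt_avec_eq {m : ℕ} (hm : 1 ≤ m) {a : ℝ} (ha : 0 < a) (s : ℝ)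
    {f : EuclideanSpace ℝ (Fin (m + 1)) → ℝ} (hf : ∀ θ, f (-θ) = f θ) :
    surfInt (m + 1) s (avec (m + 1) a) f =
      2 * ∫ y : EuclideanSpace ℝ (Fin m), f (gnomonic 1 a y) *
        ((‖y‖ ^ 2 + a) ^ s * (1 + ‖y‖ ^ 2) ^ (-(((m : ℝ) + 1) / 2 + s))) ∂μH[(m : ℝ)] := by
  have h1 : |(1 : ℝ)| = 1 := by simp
  have h2 : |(-1 : ℝ)| = 1 := by simp
  have hdim : (((m + 1 : ℕ) : ℝ)) - 1 = m := by simp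
  rw [surfInt, hdim, restrict_ellipsoid hm ha]
  set ρ := (μH[(m : ℝ)] : Measure (EuclideanSpace ℝ (Fin m))).withDensity
    fun y => ENNReal.ofReal (gnomonicScale a y ^ m * gnomonicStretch a y) with hρ
  set g : EuclideanSpace ℝ (Fin (m + 1)) → ℝ := fun θ =>
    f θ / (‖θ‖ ^ (((m + 1 : ℕ) : ℝ) + 2 * s) * ‖Avec (m + 1) (avec (m + 1) a) θ‖) with hg
  have hgσ : g ∘ gnomonic (-1) a = g ∘ gnomonic 1 a := by
    funext y
    have hfσ : f (gnomonic (-1) a y) = f (gnomonic 1 a y) := by rw [← neg_gnomonic, hf]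
    simp only [Function.comp_apply, hg, norm_gnomonic ha h1, norm_gnomonic ha h2,
      norm_Avec_gnomonic ha h1, norm_Avec_gnomonic ha h2, hfσ]
  have hint : ∫ θ, g θ ∂(Measure.map (gnomonic 1 a) ρ + Measure.map (gnomonic (-1) a) ρ) =
      2 * ∫ y, g (gnomonic 1 a y) ∂ρ := by
    by_cases hI : Integrable (g ∘ gnomonic 1 a) ρ
    · rw [integral_add_measure ((measurableEmbedding_gnomonic ha h1).integrable_map_iff.2 hI)
          ((measurableEmbedding_gnomonic ha h2).integrable_map_iff.2 (hgσ ▸ hI)),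
        (measurableEmbedding_gnomonic ha h1).integral_map,
        (measurableEmbedding_gnomonic ha h2).integral_map, two_mul]
      exact congrArg (_ + ∫ y, · y ∂ρ) hgσ
    · rw [integral_undef, show ∫ y, g (gnomonic 1 a y) ∂ρ = 0 from integral_undef hI, mul_zero]
      intro h
      exact hI ((measurableEmbedding_gnomonic ha h1).integrable_map_iff.1 h.left_of_add_measure)
  have hcont := continuous_gnomonicScale (m := m) ha
  rw [hint, hρ, integral_withDensity_eq_integral_toReal_smul]
  · congr 2
    funext y
    rw [ENNReal.toReal_ofReal (mul_nonneg (pow_nonneg (gnomonicScale_pos ha y).le m)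
      (gnomonicStretch_nonneg a y)), ← gnomonic_density ha h1, smul_eq_mul, hg]
    ring
  · unfold gnomonicStretch
    fun_prop
  · exact ae_of_all _ fun _ => ENNReal.ofReal_lt_top

theorem pow_mul_surfInt_avec_eq {m : ℕ} (hm : 1 ≤ m) {a : ℝ} (ha : 0 < a) (s : ℝ) (i : ℕ)
    {f : EuclideanSpace ℝ (Fin (m + 1)) → ℝ} (hf : ∀ θ, f (-θ) = f θ)
    {g : EuclideanSpace ℝ (Fin m) → ℝ}
    (hfg : ∀ y, f (gnomonic 1 a y) = gnomonicScale a y ^ (2 * i) * g y) :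
    a ^ i * surfInt (m + 1) s (avec (m + 1) a) f =
      2 * a ^ s * ∫ y : EuclideanSpace ℝ (Fin m), g y *
        ((1 + ‖y‖ ^ 2 / a) ^ (s - i) * (1 + ‖y‖ ^ 2) ^ (-(((m : ℝ) + 1) / 2 + s)))
          ∂μH[(m : ℝ)] := by
  rw [surfInt_avec_eq hm ha s hf, mul_left_comm, mul_assoc]
  congr 1
  rw [← integral_const_mul, ← integral_const_mul]
  congr 1
  funext y
  have hA : 0 < ‖y‖ ^ 2 + a := by positivity
  have h1 : gnomonicScale a y ^ (2 * i) = (‖y‖ ^ 2 + a) ^ (-(i : ℝ)) := by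
    rw [← gnomonicScale_rpow ha, ← Real.rpow_natCast]
    norm_num
  have h2 : (‖y‖ ^ 2 + a) ^ (-(i : ℝ)) * (‖y‖ ^ 2 + a) ^ s = (‖y‖ ^ 2 + a) ^ (s - i) := by
    rw [← Real.rpow_add hA]
    congr 1
    ring
  have h3 : a ^ i * (‖y‖ ^ 2 + a) ^ (s - i) = a ^ s * (1 + ‖y‖ ^ 2 / a) ^ (s - i) := by
    have h4 : ‖y‖ ^ 2 + a = a * (1 + ‖y‖ ^ 2 / a) := by
      field_simp
      ring
    rw [h4, Real.mul_rpow ha.le (by positivity), ← mul_assoc, ← Real.rpow_natCast,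
      ← Real.rpow_add ha]
    congr 2
    ring
  rw [hfg, h1]
  linear_combination (a ^ i * g y * (1 + ‖y‖ ^ 2) ^ (-(((m : ℝ) + 1) / 2 + s))) * h2 +
    (g y * (1 + ‖y‖ ^ 2) ^ (-(((m : ℝ) + 1) / 2 + s))) * h3

theorem integrable_pow_mul_rpow_one_add_norm_sq {V : Type*} [NormedAddCommGroup V] [NormedSpace ℝ V]
    [FiniteDimensional ℝ V] [MeasurableSpace V] [BorelSpace V] (μ : Measure V) [μ.IsAddHaarMeasure]
    {l : V → ℝ} (hl : Continuous l) (hle : ∀ v, |l v| ≤ ‖v‖) {j : ℕ} {p : ℝ}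
    (hp : (Module.finrank ℝ V : ℝ) + 2 * j < 2 * p) :
    Integrable (fun v => l v ^ (2 * j) * (1 + ‖v‖ ^ 2) ^ (-p)) μ := by
  have h := integrable_rpow_neg_one_add_norm_sq (μ := μ)
    (show (Module.finrank ℝ V : ℝ) < 2 * p - 2 * j by linarith)
  have hpos (v : V) : 0 < 1 + ‖v‖ ^ 2 := by positivity
  refine h.mono' ?_ (ae_of_all _ fun v => ?_)
  · refine Continuous.aestronglyMeasurable ((hl.pow _).mul ?_)
    exact (by fun_prop : Continuous fun v : V => 1 + ‖v‖ ^ 2).rpow_const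
      fun v => Or.inl (hpos v).ne'
  · have h1 : l v ^ (2 * j) ≤ (1 + ‖v‖ ^ 2) ^ (j : ℝ) := by
      rw [Real.rpow_natCast, pow_mul]
      refine pow_le_pow_left₀ (sq_nonneg _) ?_ j
      have := sq_le_sq' (by linarith [neg_abs_le (l v), hle v, norm_nonneg v])
        ((le_abs_self (l v)).trans (hle v))
      linarith
    have h2 : (0 : ℝ) ≤ l v ^ (2 * j) := (even_two_mul j).pow_nonneg _
    have h3 : (0 : ℝ) ≤ (1 + ‖v‖ ^ 2) ^ (-p) := Real.rpow_nonneg (hpos v).le _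
    rw [Real.norm_eq_abs, abs_of_nonneg (mul_nonneg h2 h3)]
    refine (mul_le_mul_of_nonneg_right h1 h3).trans_eq ?_
    rw [← Real.rpow_add (hpos v)]
    congr 1
    ring

theorem rpow_one_add_div_le {r a c : ℝ} (hr : 0 ≤ r) (ha : 1 ≤ a) :
    (1 + r / a) ^ c ≤ 1 + (1 + r) ^ c := by
  have ha0 : 0 < a := by linarith
  have h1 : 1 ≤ 1 + r / a := by
    have : 0 ≤ r / a := by positivity
    linarith
  have h2 : 1 + r / a ≤ 1 + r := by
    gcongr
    exact div_le_self hr ha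
  rcases le_total 0 c with hc | hc
  · linarith [Real.rpow_le_rpow (by linarith) h2 hc]
  · have h3 : (0 : ℝ) ≤ (1 + r) ^ c := by positivity
    linarith [Real.rpow_le_one_of_one_le_of_nonpos h1 hc]

theorem tendsto_integral_moment {m : ℕ} (μ : Measure (EuclideanSpace ℝ (Fin m)))
    [μ.IsAddHaarMeasure] (l : Fin m) {s : ℝ} {i j : ℕ} (hji : j ≤ i) (hj : (j : ℝ) < s + 1 / 2) :
    Tendsto (fun a : ℝ => ∫ y, y l ^ (2 * j) *
        ((1 + ‖y‖ ^ 2 / a) ^ (s - i) * (1 + ‖y‖ ^ 2) ^ (-(((m : ℝ) + 1) / 2 + s))) ∂μ)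
      atTop (nhds (∫ y, y l ^ (2 * j) * (1 + ‖y‖ ^ 2) ^ (-(((m : ℝ) + 1) / 2 + s)) ∂μ)) := by
  have hl : Continuous fun y : EuclideanSpace ℝ (Fin m) => y l := by fun_prop
  have hle (y : EuclideanSpace ℝ (Fin m)) : |y l| ≤ ‖y‖ := PiLp.norm_apply_le y l
  have hji' : (j : ℝ) ≤ i := by exact_mod_cast hji
  have hI1 := integrable_pow_mul_rpow_one_add_norm_sq μ hl hle (j := j)
    (p := ((m : ℝ) + 1) / 2 + s) (by rw [finrank_euclideanSpace_fin]; linarith)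
  have hI2 := integrable_pow_mul_rpow_one_add_norm_sq μ hl hle (j := j)
    (p := ((m : ℝ) + 1) / 2 + i) (by rw [finrank_euclideanSpace_fin]; linarith)
  have hpos (y : EuclideanSpace ℝ (Fin m)) : 0 < 1 + ‖y‖ ^ 2 := by positivity
  refine tendsto_integral_filter_of_dominated_convergence _ ?_ ?_ (hI1.add hI2) ?_
  · filter_upwards [eventually_ge_atTop (1 : ℝ)] with a ha
    have hpos' (y : EuclideanSpace ℝ (Fin m)) : 0 < 1 + ‖y‖ ^ 2 / a := by positivity
    have h1 : Continuous fun y : EuclideanSpace ℝ (Fin m) => (1 + ‖y‖ ^ 2 / a) ^ (s - i) :=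
      (by fun_prop : Continuous fun y : EuclideanSpace ℝ (Fin m) => 1 + ‖y‖ ^ 2 / a).rpow_const
        fun y => Or.inl (hpos' y).ne'
    have h2 : Continuous fun y : EuclideanSpace ℝ (Fin m) =>
        (1 + ‖y‖ ^ 2) ^ (-(((m : ℝ) + 1) / 2 + s)) :=
      (by fun_prop : Continuous fun y : EuclideanSpace ℝ (Fin m) => 1 + ‖y‖ ^ 2).rpow_const
        fun y => Or.inl (hpos y).ne'
    exact ((hl.pow _).mul (h1.mul h2)).aestronglyMeasurable
  · filter_upwards [eventually_ge_atTop (1 : ℝ)] with a ha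
    refine ae_of_all _ fun y => ?_
    have h1 : (0 : ℝ) ≤ y l ^ (2 * j) := (even_two_mul j).pow_nonneg _
    have h2 : (0 : ℝ) ≤ (1 + ‖y‖ ^ 2 / a) ^ (s - i) := by positivity
    have h3 : (0 : ℝ) ≤ (1 + ‖y‖ ^ 2) ^ (-(((m : ℝ) + 1) / 2 + s)) := by positivity
    have h4 : (1 + ‖y‖ ^ 2) ^ (s - i) * (1 + ‖y‖ ^ 2) ^ (-(((m : ℝ) + 1) / 2 + s)) =
        (1 + ‖y‖ ^ 2) ^ (-(((m : ℝ) + 1) / 2 + i)) := by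
      rw [← Real.rpow_add (hpos y)]
      congr 1
      ring
    rw [Real.norm_eq_abs, abs_of_nonneg (by positivity), Pi.add_apply, ← h4, ← mul_add,
      ← one_add_mul]
    gcongr
    exact rpow_one_add_div_le (sq_nonneg _) ha
  · refine ae_of_all _ fun y => ?_
    have h1 : Tendsto (fun a : ℝ => 1 + ‖y‖ ^ 2 / a) atTop (nhds 1) := by
      simpa using (tendsto_const_nhds (x := ‖y‖ ^ 2)).div_atTop tendsto_id |>.const_add (1 : ℝ)
    have h2 := (h1.rpow_const (p := s - i) (Or.inl one_ne_zero)).mul_const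
      ((1 + ‖y‖ ^ 2) ^ (-(((m : ℝ) + 1) / 2 + s))) |>.const_mul (y l ^ (2 * j))
    simpa using h2

theorem tendsto_pow_mul_rpow_one_add_sq {F : Filter ℝ}
    (hF : Tendsto (fun x : ℝ => 1 + x ^ 2) F atTop) {j : ℕ} {s : ℝ} (hj : (j : ℝ) + 1 / 2 < s) :
    Tendsto (fun x : ℝ => x ^ (2 * j + 1) * (1 + x ^ 2) ^ (-s)) F (nhds 0) := by
  have h := (tendsto_rpow_neg_atTop (show 0 < s - (j + 1 / 2) by linarith)).comp hF
  refine squeeze_zero_norm (fun x => ?_) h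
  have hpos : 0 < 1 + x ^ 2 := by positivity
  have h1 : |x| ^ (2 * j + 1) ≤ (1 + x ^ 2) ^ ((j : ℝ) + 1 / 2) := by
    have h2 : |x| ≤ (1 + x ^ 2) ^ (1 / 2 : ℝ) := by
      rw [← Real.sqrt_eq_rpow]
      exact Real.abs_le_sqrt (by linarith)
    refine (pow_le_pow_left₀ (abs_nonneg x) h2 _).trans_eq ?_
    rw [← Real.rpow_natCast, ← Real.rpow_mul hpos.le]
    congr 1
    push_cast
    ring
  have h3 : (0 : ℝ) ≤ (1 + x ^ 2) ^ (-s) := by positivity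
  rw [norm_mul, norm_pow, Real.norm_eq_abs, Real.norm_eq_abs, abs_of_nonneg h3]
  refine (mul_le_mul_of_nonneg_right h1 h3).trans_eq ?_
  rw [← Real.rpow_add hpos, Function.comp_apply]
  congr 1
  ring

theorem integrable_pow_mul_rpow_one_add_sq {j : ℕ} {s : ℝ} (hj : (j : ℝ) < s + 1 / 2) :
    Integrable fun x : ℝ => x ^ (2 * j) * (1 + x ^ 2) ^ (-(1 + s)) := by
  have h := integrable_pow_mul_rpow_one_add_norm_sq (volume : Measure ℝ) continuous_id
    (fun x => le_rfl) (j := j) (p := 1 + s) (by rw [Module.finrank_self, Nat.cast_one]; linarith)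
  simpa using h

theorem integral_pow_succ_mul_rpow_one_add_sq {j : ℕ} {s : ℝ} (hj : (j : ℝ) + 1 / 2 < s) :
    ∫ x : ℝ, x ^ (2 * (j + 1)) * (1 + x ^ 2) ^ (-(1 + s)) =
      (1 + 2 * (j : ℝ)) / (2 * s - 2 * j - 1) *
        ∫ x : ℝ, x ^ (2 * j) * (1 + x ^ 2) ^ (-(1 + s)) := by
  have hI0 := integrable_pow_mul_rpow_one_add_sq (j := j) (s := s) (by linarith)
  have hI1 := integrable_pow_mul_rpow_one_add_sq (j := j + 1) (s := s) (by push_cast; linarith)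
  have hderiv (x : ℝ) : HasDerivAt (fun x : ℝ => x ^ (2 * j + 1) * (1 + x ^ 2) ^ (-s))
      ((1 + 2 * (j : ℝ)) * (x ^ (2 * j) * (1 + x ^ 2) ^ (-(1 + s))) -
        (2 * s - 2 * j - 1) * (x ^ (2 * (j + 1)) * (1 + x ^ 2) ^ (-(1 + s)))) x := by
    have hpos : 0 < 1 + x ^ 2 := by positivity
    have h1 : HasDerivAt (fun x : ℝ => 1 + x ^ 2) (2 * x) x := by
      simpa using (hasDerivAt_pow 2 x).const_add 1
    have h2 := (hasDerivAt_pow (2 * j + 1) x).mul (h1.rpow_const (p := -s) (Or.inl hpos.ne'))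
    refine h2.congr_deriv ?_
    have h3 : (1 + x ^ 2) ^ (-s) = (1 + x ^ 2) ^ (-(1 + s)) * (1 + x ^ 2) := by
      rw [← Real.rpow_add_one hpos.ne']
      congr 1
      ring
    have h4 : -s - 1 = -(1 + s) := by ring
    rw [h4, h3, Nat.add_sub_cancel]
    push_cast
    ring
  have htop : Tendsto (fun x : ℝ => 1 + x ^ 2) atTop atTop :=
    tendsto_atTop_add_const_left _ _ (tendsto_pow_atTop two_ne_zero)
  have hbot : Tendsto (fun x : ℝ => 1 + x ^ 2) atBot atTop :=
    by
    simpa [Function.comp_def] using htop.comp tendsto_abs_atBot_atTop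
  have h := integral_of_hasDerivAt_of_tendsto hderiv
    ((hI0.const_mul _).sub (hI1.const_mul _)) (tendsto_pow_mul_rpow_one_add_sq hbot hj)
    (tendsto_pow_mul_rpow_one_add_sq htop hj)
  rw [integral_sub (hI0.const_mul _) (hI1.const_mul _), integral_const_mul, integral_const_mul] at h
  have h5 : 2 * s - 2 * j - 1 ≠ 0 := by linarith
  rw [div_mul_eq_mul_div, eq_div_iff h5]
  linarith

theorem integral_pow_mul_rpow_one_add_sq {i : ℕ} {s : ℝ} (hi : (i : ℝ) < s + 1 / 2) :
    ∫ x : ℝ, x ^ (2 * i) * (1 + x ^ 2) ^ (-(1 + s)) =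
      (∏ k ∈ Finset.range i, (1 + 2 * (k : ℝ)) / (2 * s - 2 * (k : ℝ) - 1)) *
        ∫ x : ℝ, x ^ (2 * 0) * (1 + x ^ 2) ^ (-(1 + s)) := by
  induction i with
  | zero => simp
  | succ j ih =>
    push_cast at hi
    rw [integral_pow_succ_mul_rpow_one_add_sq (by linarith), ih (by linarith),
      Finset.prod_range_succ]
    ring

theorem integral_rpow_add_norm_sq {V : Type*} [NormedAddCommGroup V] [NormedSpace ℝ V]
    [FiniteDimensional ℝ V] [MeasurableSpace V] [BorelSpace V] (μ : Measure V) [μ.IsAddHaarMeasure]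
    {q : V → ℝ} (hq : ∀ (c : ℝ) v, q (c • v) = c ^ 2 * q v) (hq0 : ∀ v, 0 ≤ q v) {b : ℝ}
    (hb : 0 < b) (p : ℝ) :
    ∫ v, (b + q v) ^ (-p) ∂μ =
      b ^ ((Module.finrank ℝ V : ℝ) / 2 - p) * ∫ v, (1 + q v) ^ (-p) ∂μ := by
  have hR : 0 < Real.sqrt b := Real.sqrt_pos.2 hb
  have h := Measure.integral_comp_smul μ (fun v => (1 + q v) ^ (-p)) (Real.sqrt b)⁻¹
  have h1 : |(((Real.sqrt b)⁻¹ ^ Module.finrank ℝ V)⁻¹)| = b ^ ((Module.finrank ℝ V : ℝ) / 2) := by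
    rw [inv_pow, inv_inv, abs_of_pos (pow_pos hR _), Real.sqrt_eq_rpow, ← Real.rpow_natCast,
      ← Real.rpow_mul hb.le]
    congr 1
    ring
  rw [h1, smul_eq_mul] at h
  rw [sub_eq_add_neg, Real.rpow_add hb, mul_right_comm, ← h, mul_comm, ← integral_const_mul]
  congr 1
  funext v
  have h2 : b + q v = b * (1 + q ((Real.sqrt b)⁻¹ • v)) := by
    rw [hq, inv_pow, Real.sq_sqrt hb.le]
    field_simp
  have h3 := hq0 ((Real.sqrt b)⁻¹ • v)
  rw [h2, Real.mul_rpow hb.le (by linarith)]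

theorem integral_moment_volume (k : ℕ) {s : ℝ} {j : ℕ} (hj : (j : ℝ) < s + 1 / 2) :
    ∫ y : EuclideanSpace ℝ (Fin (k + 1)), y 0 ^ (2 * j) *
        (1 + ‖y‖ ^ 2) ^ (-((((k + 1 : ℕ) : ℝ) + 1) / 2 + s)) =
      (∫ x : ℝ, x ^ (2 * j) * (1 + x ^ 2) ^ (-(1 + s))) *
        ∫ z : Fin k → ℝ, (1 + ∑ i, z i ^ 2) ^ (-((((k + 1 : ℕ) : ℝ) + 1) / 2 + s)) := by
  set p : ℝ := (((k + 1 : ℕ) : ℝ) + 1) / 2 + s with hp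
  have hint : Integrable (fun y : EuclideanSpace ℝ (Fin (k + 1)) =>
      y 0 ^ (2 * j) * (1 + ‖y‖ ^ 2) ^ (-p)) :=
    integrable_pow_mul_rpow_one_add_norm_sq volume (by fun_prop)
      (fun y => PiLp.norm_apply_le y 0) (by rw [finrank_euclideanSpace_fin, hp]; linarith)
  have hmp : MeasurePreserving
      ((MeasurableEquiv.piFinSuccAbove (fun _ : Fin (k + 1) => ℝ) 0).symm.trans
        (MeasurableEquiv.toLp 2 (Fin (k + 1) → ℝ)))
      (volume : Measure (ℝ × (Fin k → ℝ))) volume :=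
    ((volume_preserving_piFinSuccAbove (fun _ : Fin (k + 1) => ℝ) 0).symm _).trans
      (PiLp.volume_preserving_toLp (Fin (k + 1)))
  have hcomp : (fun y : EuclideanSpace ℝ (Fin (k + 1)) =>
      y 0 ^ (2 * j) * (1 + ‖y‖ ^ 2) ^ (-p)) ∘
      ((MeasurableEquiv.piFinSuccAbove (fun _ : Fin (k + 1) => ℝ) 0).symm.trans
        (MeasurableEquiv.toLp 2 (Fin (k + 1) → ℝ))) =
      fun w => w.1 ^ (2 * j) * ((1 + w.1 ^ 2) + ∑ i, w.2 i ^ 2) ^ (-p) := by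
    funext w
    simp [EuclideanSpace.real_norm_sq_eq, Fin.sum_univ_succ, MeasurableEquiv.piFinSuccAbove,
      add_assoc]
  have hint' := (hmp.integrable_comp_emb (MeasurableEquiv.measurableEmbedding _)).2 hint
  rw [hcomp] at hint'
  rw [← hmp.integral_comp' (fun y : EuclideanSpace ℝ (Fin (k + 1)) =>
      y 0 ^ (2 * j) * (1 + ‖y‖ ^ 2) ^ (-p))]
  refine (congrArg (fun g : ℝ × (Fin k → ℝ) → ℝ => ∫ w, g w) hcomp).trans ?_
  rw [Measure.volume_eq_prod, integral_prod _ hint', ← integral_mul_const]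
  congr 1
  funext x
  dsimp only
  rw [integral_const_mul, integral_rpow_add_norm_sq (volume : Measure (Fin k → ℝ))
    (fun c v => by simp [mul_pow, Finset.mul_sum])
    (fun v => Finset.sum_nonneg fun i _ => sq_nonneg (v i)) (by positivity), Module.finrank_fin_fun,
    mul_assoc]
  congr 3
  rw [hp]
  push_cast
  ring

theorem integral_moment_zero_pos {m : ℕ} (μ : Measure (EuclideanSpace ℝ (Fin m)))
    [μ.IsAddHaarMeasure] {s : ℝ} (hs : 0 < s) :
    0 < ∫ y : EuclideanSpace ℝ (Fin m), (1 + ‖y‖ ^ 2) ^ (-(((m : ℝ) + 1) / 2 + s)) ∂μ := by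
  have hpos (y : EuclideanSpace ℝ (Fin m)) : 0 < 1 + ‖y‖ ^ 2 := by positivity
  have hint := integrable_rpow_neg_one_add_norm_sq (μ := μ)
    (r := 2 * (((m : ℝ) + 1) / 2 + s)) (by rw [finrank_euclideanSpace_fin]; linarith)
  refine integral_pos_of_integrable_nonneg_nonzero (x := 0) ?_ ?_ (fun y => by positivity) (by simp)
  · exact (by fun_prop : Continuous fun y : EuclideanSpace ℝ (Fin m) => 1 + ‖y‖ ^ 2).rpow_const
      fun y => Or.inl (hpos y).ne'
  · convert hint using 3
    ring

/-- Ratio of the moments of the Haar measure weighted by a power of `1 + |y|²`. -/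
theorem integral_moment_div (k : ℕ) (μ : Measure (EuclideanSpace ℝ (Fin (k + 1))))
    [μ.IsAddHaarMeasure] {s : ℝ} (hs : 0 < s) {i : ℕ} (hi : (i : ℝ) < s + 1 / 2) :
    (∫ y, y 0 ^ (2 * i) * (1 + ‖y‖ ^ 2) ^ (-((((k + 1 : ℕ) : ℝ) + 1) / 2 + s)) ∂μ) /
        ∫ y, (1 + ‖y‖ ^ 2) ^ (-((((k + 1 : ℕ) : ℝ) + 1) / 2 + s)) ∂μ =
      ∏ k ∈ Finset.range i, (1 + 2 * (k : ℝ)) / (2 * s - 2 * (k : ℝ) - 1) := by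
  have hμ := μ.isAddLeftInvariant_eq_smul volume
  have hne := (integral_moment_zero_pos μ hs).ne'
  rw [div_eq_iff hne]
  have h0 := integral_moment_volume k (s := s) (j := 0) (by push_cast; linarith)
  rw [hμ, integral_smul_nnreal_measure, integral_smul_nnreal_measure, integral_moment_volume k hi,
    integral_pow_mul_rpow_one_add_sq hi, mul_assoc, ← h0, ← mul_smul_comm]
  simp

theorem Gamma_ratio_eq_prod {s : ℝ} {i : ℕ} (hi : (i : ℝ) < s + 1 / 2) :
    Real.Gamma ((i : ℝ) + 1 / 2) * Real.Gamma (s - (i : ℝ) + 1 / 2) /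
        (Real.Gamma (1 / 2) * Real.Gamma (s + 1 / 2)) =
      ∏ k ∈ Finset.range i, (1 + 2 * (k : ℝ)) / (2 * s - 2 * (k : ℝ) - 1) := by
  induction i with
  | zero =>
    have h1 := Real.Gamma_pos_of_pos (show (0 : ℝ) < 1 / 2 by norm_num)
    have h2 := Real.Gamma_pos_of_pos (show (0 : ℝ) < s + 1 / 2 by simpa using hi)
    simp only [Nat.cast_zero, zero_add, sub_zero, Finset.range_zero, Finset.prod_empty]
    exact div_self (by positivity)
  | succ j ih =>
    push_cast at hi ⊢
    have hj : (0 : ℝ) < j + 1 / 2 := by positivity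
    have hsj : 0 < s - j - 1 / 2 := by linarith
    rw [Finset.prod_range_succ, ← ih (by linarith),
      show (j : ℝ) + 1 + 1 / 2 = (j + 1 / 2) + 1 by ring, Real.Gamma_add_one hj.ne',
      show s - (j : ℝ) + 1 / 2 = (s - j - 1 / 2) + 1 by ring, Real.Gamma_add_one hsj.ne',
      show s - ((j : ℝ) + 1) + 1 / 2 = s - j - 1 / 2 by ring]
    have h1 : 2 * s - 2 * j - 1 ≠ 0 := by linarith
    have h2 : (s - j - 1 / 2) * ((1 + 2 * (j : ℝ)) / (2 * s - 2 * j - 1)) = j + 1 / 2 := by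
      rw [mul_div_assoc', div_eq_iff h1]
      ring
    rw [← h2]
    ring

theorem tendsto_pow_mul_surfInt_avec_div {k : ℕ} {s : ℝ} (hs : 0 < s) {i j : ℕ} (hji : j ≤ i)
    (hj : (j : ℝ) < s + 1 / 2) {f : ℝ → EuclideanSpace ℝ (Fin (k + 1 + 1)) → ℝ}
    (hf : ∀ a θ, f a (-θ) = f a θ)
    (hfg : ∀ a y, f a (gnomonic 1 a y) = gnomonicScale a y ^ (2 * i) * y 0 ^ (2 * j)) :
    Tendsto (fun a : ℝ => a ^ i * surfInt (k + 1 + 1) s (avec (k + 1 + 1) a) (f a) /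
        J0fun (k + 1 + 1) s (avec (k + 1 + 1) a)) atTop
      (nhds (∏ k ∈ Finset.range j, (1 + 2 * (k : ℝ)) / (2 * s - 2 * (k : ℝ) - 1))) := by
  have hHaar : (μH[((k + 1 : ℕ) : ℝ)] :
      Measure (EuclideanSpace ℝ (Fin (k + 1)))).IsAddHaarMeasure := by
    have h : (μH[(Module.finrank ℝ (EuclideanSpace ℝ (Fin (k + 1))) : ℝ)] :
      Measure (EuclideanSpace ℝ (Fin (k + 1)))).IsAddHaarMeasure := inferInstance
    rwa [finrank_euclideanSpace_fin] at h
  have hnum := tendsto_integral_moment (μH[((k + 1 : ℕ) : ℝ)]) (0 : Fin (k + 1)) hji hj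
  have hden := tendsto_integral_moment (μH[((k + 1 : ℕ) : ℝ)]) (0 : Fin (k + 1)) (s := s)
    (le_refl 0) (by push_cast; linarith)
  have hpos := integral_moment_zero_pos (μH[((k + 1 : ℕ) : ℝ)] :
      Measure (EuclideanSpace ℝ (Fin (k + 1)))) hs
  rw [← integral_moment_div k (μH[((k + 1 : ℕ) : ℝ)]) hs hj]
  have hquot := hnum.div hden (by simpa using hpos.ne')
  simp only [mul_zero, pow_zero, one_mul] at hquot
  refine hquot.congr' ?_
  filter_upwards [eventually_gt_atTop 0] with a ha
  have h0 := pow_mul_surfInt_avec_eq (m := k + 1) (by omega) ha s 0 (f := fun _ => 1)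
    (g := fun _ => 1) (fun _ => rfl) (fun y => by simp)
  rw [pow_zero, one_mul] at h0
  have has : 2 * a ^ s ≠ 0 := (mul_pos two_pos (Real.rpow_pos_of_pos ha s)).ne'
  rw [pow_mul_surfInt_avec_eq (m := k + 1) (by omega) ha s i (hf a) (hfg a), J0fun, h0,
    mul_div_mul_left _ _ has]
  simp

/-- asymptotics of `J_i^{(n)}/J₀` and `a^i J_i^{(1)}/J₀` as `a → ∞`. -/
theorem statement17 (n : ℕ) (s : ℝ) (i : ℕ) (hn : 2 ≤ n) (hs : 0 < s) :
    Filter.Tendsto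
      (fun a : ℝ => Jik n s (avec n a) i (⟨n - 1, by omega⟩ : Fin n) / J0fun n s (avec n a))
      Filter.atTop (nhds 1) ∧
    (s > (i : ℝ) - 1 / 2 →
      Filter.Tendsto
        (fun a : ℝ => a ^ i * Jik n s (avec n a) i (⟨0, by omega⟩ : Fin n) / J0fun n s (avec n a))
        Filter.atTop
        (nhds (Real.Gamma ((i : ℝ) + 1 / 2) * Real.Gamma (s - (i : ℝ) + 1 / 2) /
          (Real.Gamma (1 / 2) * Real.Gamma (s + 1 / 2)))) ∧
      Real.Gamma ((i : ℝ) + 1 / 2) * Real.Gamma (s - (i : ℝ) + 1 / 2) /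
          (Real.Gamma (1 / 2) * Real.Gamma (s + 1 / 2)) =
        ∏ k ∈ Finset.range i, (1 + 2 * (k : ℝ)) / (2 * s - 2 * (k : ℝ) - 1)) := by
  obtain ⟨k, rfl⟩ : ∃ k, n = k + 1 + 1 := ⟨n - 2, by omega⟩
  have hlast : (⟨k + 1 + 1 - 1, by omega⟩ : Fin (k + 1 + 1)) = Fin.last (k + 1) := rfl
  have hzero : (⟨0, by omega⟩ : Fin (k + 1 + 1)) = Fin.castSucc (0 : Fin (k + 1)) := rfl
  refine ⟨?_, fun hi => ?_⟩
  · have h := tendsto_pow_mul_surfInt_avec_div (k := k) hs (Nat.zero_le i)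
      (by push_cast; linarith) (f := fun _ θ => θ (Fin.last (k + 1)) ^ (2 * i))
      (fun _ θ => by simp [pow_mul]) (fun a y => by simp)
    rw [Finset.prod_range_zero] at h
    refine h.congr fun a => ?_
    rw [Jik, hlast, show avec (k + 1 + 1) a (Fin.last (k + 1)) = a by simp [avec]]
  · have hi' : (i : ℝ) < s + 1 / 2 := by linarith
    refine ⟨?_, Gamma_ratio_eq_prod hi'⟩
    rw [Gamma_ratio_eq_prod hi']
    refine (tendsto_pow_mul_surfInt_avec_div (k := k) hs le_rfl hi'
      (f := fun _ θ => θ (Fin.castSucc 0) ^ (2 * i))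
      (fun _ θ => by simp [pow_mul]) (fun a y => by rw [gnomonic_castSucc, one_mul, mul_pow])).congr fun a => ?_
    rw [Jik, hzero, show avec (k + 1 + 1) a (Fin.castSucc 0) = 1 by simp [avec], one_pow, one_mul]
end
end
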